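/- arXiv:1202.2071 — 2 statements merged into one kernel-verified Lean document; each statement's English description precedes it below -/
import Mathlib

section
/- There exist 𝓔₀ > 0 and C > 0 such that for every 𝓔 ≥ 𝓔₀ the following holds. There exists a unique odd, 1-periodic, twice continuously differentiable function u_* : ℝ → ℝ with u_*'(0) < 0 and E(u_*) = 𝓔 such that R(u) ≤ R(u_*) for every 1-periodic twice continuously differentiable u with E(u) = 𝓔 (i.e. u_* solves the constrained maximization problem max R(u) subject to E(u) = 𝓔). Moreover, there exists k > 0 with |𝓔 - (32/3)k³| ≤ C k² such that: sup_{x ∈ [-1/2,1/2]} |u_*(x) - 4k(2x - tanh(kx))| ≤ C k² e^{-k}; |K(u_*) - (8/3)k²| ≤ C k; and |R(u_*) - (256/5)k⁵| ≤ C k⁴. -/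
open MeasureTheory intervalIntegral Set Real

/-- Energy `K(u) = (1/2)∫_{-1/2}^{1/2} u²` of a 1-periodic function. -/
noncomputable def energy (u : ℝ → ℝ) : ℝ :=
  (1/2) * ∫ x in (-(1:ℝ)/2)..(1/2), (u x) ^ 2

/-- Enstrophy `E(u) = (1/2)∫_{-1/2}^{1/2} u'²` of a 1-periodic function. -/
noncomputable def enstrophy (u : ℝ → ℝ) : ℝ :=
  (1/2) * ∫ x in (-(1:ℝ)/2)..(1/2), (deriv u x) ^ 2

/-- Enstrophy rate of change `R(u) = -∫_{-1/2}^{1/2} (u''² + u'³)`. -/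
noncomputable def rate (u : ℝ → ℝ) : ℝ :=
  -∫ x in (-(1:ℝ)/2)..(1/2), ((deriv (deriv u) x) ^ 2 + (deriv u x) ^ 3)

/-- `u` is an odd, 1-periodic, C² solution of the constrained maximization problem
`max R(u)` subject to `E(u) = 𝓔`, normalized by `u'(0) < 0`. -/
def IsOddMaximizer (𝓔 : ℝ) (u : ℝ → ℝ) : Prop :=
  (∀ x : ℝ, u (-x) = -u x) ∧ (∀ x : ℝ, u (x + 1) = u x) ∧ ContDiff ℝ 2 u ∧
    deriv u 0 < 0 ∧ enstrophy u = 𝓔 ∧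
    ∀ v : ℝ → ℝ, (∀ x : ℝ, v (x + 1) = v x) → ContDiff ℝ 2 v → enstrophy v = 𝓔 →
      rate v ≤ rate u

/-- Two global solutions of `d'' = c d` with bounded `c` that vanish to first order at `0` vanish. -/
theorem eq_zero_of_linear_ode {d e c : ℝ → ℝ} {K : ℝ}
    (hd : ∀ x, HasDerivAt d (e x) x) (he : ∀ x, HasDerivAt e (c x * d x) x)
    (hc : ∀ x, |c x| ≤ K) (d0 : d 0 = 0) (e0 : e 0 = 0) : ∀ x, d x = 0 ∧ e x = 0 := by
  have hK : 0 ≤ K := (abs_nonneg _).trans (hc 0)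
  set v : ℝ → ℝ × ℝ → ℝ × ℝ := fun t p => (p.2, c t * p.1) with hv
  have hlip : ∀ t, LipschitzOnWith (⟨max 1 K, le_max_of_le_left zero_le_one⟩ : NNReal)
      (v t) (univ : Set (ℝ × ℝ)) := by
    intro t
    apply LipschitzOnWith.of_dist_le_mul
    intro p _ q _
    have h1 : |p.1 - q.1| ≤ dist p q := by
      rw [Prod.dist_eq, Real.dist_eq]; exact le_max_left _ _
    have h2 : |p.2 - q.2| ≤ dist p q := by
      rw [Prod.dist_eq, Real.dist_eq, Real.dist_eq]; exact le_max_right _ _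
    have h3 : (0:ℝ) ≤ dist p q := dist_nonneg
    change dist (v t p) (v t q) ≤ max 1 K * dist p q
    rw [Prod.dist_eq, Real.dist_eq, Real.dist_eq]
    apply max_le
    · calc |p.2 - q.2| ≤ 1 * dist p q := by simpa using h2
        _ ≤ max 1 K * dist p q := by gcongr; exact le_max_left _ _
    · change |c t * p.1 - c t * q.1| ≤ _
      rw [← mul_sub, abs_mul]
      gcongr
      exact (hc t).trans (le_max_right _ _)
  have key := ODE_solution_unique_univ (v := v) (s := fun _ => univ)
    (f := fun t => (d t, e t)) (g := fun _ => (0, 0)) (t₀ := 0) hlip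
    (fun t => ⟨(hd t).prodMk (he t), mem_univ _⟩)
    (fun t => ⟨(hasDerivAt_const t ((0:ℝ), (0:ℝ))).congr_deriv (by simp [hv]; rfl), mem_univ _⟩)
    (by simp [d0, e0])
  intro x
  have := congrFun key x
  simpa using this

/-- `w` is a `1`-periodic solution, with derivative `w'`, of the stationary Korteweg-de Vries
equation `w'' = -(3/2) w² + lam w + mu`. -/
structure IsCnoidal (lam mu : ℝ) (w w' : ℝ → ℝ) : Prop where
  hasDeriv : ∀ x, HasDerivAt w (w' x) x
  hasDeriv₂ : ∀ x, HasDerivAt w' (-(3/2) * w x ^ 2 + lam * w x + mu) x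
  periodic : Function.Periodic w 1

namespace IsCnoidal

variable {lam mu : ℝ} {w w' v v' : ℝ → ℝ}

theorem continuous (h : IsCnoidal lam mu w w') : Continuous w :=
  continuous_iff_continuousAt.2 fun x => (h.hasDeriv x).continuousAt

theorem continuous_deriv (h : IsCnoidal lam mu w w') : Continuous w' :=
  continuous_iff_continuousAt.2 fun x => (h.hasDeriv₂ x).continuousAt

theorem periodic_deriv (h : IsCnoidal lam mu w w') : Function.Periodic w' 1 := by
  intro x
  have h1 := (h.hasDeriv (x + 1)).comp_add_const x 1
  have h2 : (fun y => w (y + 1)) = w := funext h.periodic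
  rw [h2] at h1
  exact h1.unique (h.hasDeriv x)

theorem translate (h : IsCnoidal lam mu w w') (a : ℝ) :
    IsCnoidal lam mu (fun x => w (x + a)) (fun x => w' (x + a)) where
  hasDeriv x := (h.hasDeriv (x + a)).comp_add_const x a
  hasDeriv₂ x := (h.hasDeriv₂ (x + a)).comp_add_const x a
  periodic x := by
    change w (x + 1 + a) = w (x + a)
    rw [show x + 1 + a = x + a + 1 by ring, h.periodic]

theorem reflect (h : IsCnoidal lam mu w w') :
    IsCnoidal lam mu (fun x => w (-x)) (fun x => -w' (-x)) where
  hasDeriv x := ((h.hasDeriv (-x)).comp x (hasDerivAt_neg x)).congr_deriv (by ring)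
  hasDeriv₂ x := ((h.hasDeriv₂ (-x)).comp x (hasDerivAt_neg x)).neg.congr_deriv (by ring)
  periodic x := by
    change w (-(x + 1)) = w (-x)
    rw [← h.periodic (-(x + 1))]; congr 1; ring

theorem add_const (h : IsCnoidal lam mu w w') (b : ℝ) :
    IsCnoidal (lam + 3 * b) (mu - lam * b - (3/2) * b ^ 2) (fun x => w x + b) w' where
  hasDeriv x := (h.hasDeriv x).add_const b
  hasDeriv₂ x := by
    refine (h.hasDeriv₂ x).congr_deriv ?_
    ring
  periodic x := by change w (x + 1) + b = w x + b; rw [h.periodic]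

theorem exists_bound (h : IsCnoidal lam mu w w') : ∃ B, ∀ x, |w x| ≤ B := by
  have := h.periodic.isBounded_of_continuous one_ne_zero h.continuous
  obtain ⟨B, hB⟩ := this.exists_norm_le
  exact ⟨B, fun x => hB _ (mem_range_self x)⟩

theorem ext (h : IsCnoidal lam mu w w') (k : IsCnoidal lam mu v v')
    (h0 : w 0 = v 0) (h1 : w' 0 = v' 0) : w = v ∧ w' = v' := by
  obtain ⟨B, hB⟩ := h.exists_bound
  obtain ⟨D, hD⟩ := k.exists_bound
  have key := eq_zero_of_linear_ode (d := fun x => w x - v x) (e := fun x => w' x - v' x)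
    (c := fun x => -(3/2) * (w x + v x) + lam) (K := (3/2) * (B + D) + |lam|)
    (fun x => (h.hasDeriv x).sub (k.hasDeriv x))
    (fun x => ((h.hasDeriv₂ x).sub (k.hasDeriv₂ x)).congr_deriv (by ring))
    (fun x => by
      calc |-(3/2) * (w x + v x) + lam| ≤ |-(3/2) * (w x + v x)| + |lam| := abs_add_le _ _
        _ = (3/2) * |w x + v x| + |lam| := by rw [abs_mul]; norm_num
        _ ≤ _ := by
          have := (abs_add_le (w x) (v x)).trans (add_le_add (hB x) (hD x))
          linarith)
    (by simp [h0]) (by simp [h1])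
  exact ⟨funext fun x => sub_eq_zero.1 (key x).1, funext fun x => sub_eq_zero.1 (key x).2⟩

theorem even_about (h : IsCnoidal lam mu w w') {a : ℝ} (ha : w' a = 0) (x : ℝ) :
    w (a + x) = w (a - x) := by
  have h1 := h.translate a
  have h2 := h1.reflect
  have := (h1.ext h2 (by simp) (by simp [ha])).1
  have h3 : w (x + a) = w (-x + a) := congrFun this x
  rw [add_comm, h3]; congr 1; ring

theorem periodic_of_eq (h : IsCnoidal lam mu w w') {a b : ℝ} (h0 : w a = w b) (h1 : w' a = w' b) :
    Function.Periodic w (b - a) := by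
  intro x
  have := (h.translate a).ext (h.translate b) (by simp [h0]) (by simp [h1])
  have h3 := congrFun this.1 (x - a)
  simp only [sub_add_cancel] at h3
  rw [h3]; congr 1; ring

theorem exists_energy (h : IsCnoidal lam mu w w') :
    ∃ c, ∀ x, w' x ^ 2 = -w x ^ 3 + lam * w x ^ 2 + 2 * mu * w x + c := by
  have hd : ∀ x, HasDerivAt (fun x => w' x ^ 2 + w x ^ 3 - lam * w x ^ 2 - 2 * mu * w x) 0 x := by
    intro x
    have := ((((h.hasDeriv₂ x).pow 2).add ((h.hasDeriv x).pow 3)).sub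
      (((h.hasDeriv x).pow 2).const_mul lam)).sub ((h.hasDeriv x).const_mul (2 * mu))
    refine this.congr_deriv ?_
    push_cast
    ring
  refine ⟨w' 0 ^ 2 + w 0 ^ 3 - lam * w 0 ^ 2 - 2 * mu * w 0, fun x => ?_⟩
  have := is_const_of_deriv_eq_zero (fun x => (hd x).differentiableAt) (fun x => (hd x).deriv) x 0
  linarith

theorem deriv_eq_zero_of_max (h : IsCnoidal lam mu w w') {a : ℝ} (ha : ∀ x, w x ≤ w a) :
    w' a = 0 :=
  IsLocalMax.hasDerivAt_eq_zero (Filter.Eventually.of_forall ha) (h.hasDeriv a)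

theorem deriv_eq_zero_of_min (h : IsCnoidal lam mu w w') {a : ℝ} (ha : ∀ x, w a ≤ w x) :
    w' a = 0 :=
  IsLocalMin.hasDerivAt_eq_zero (Filter.Eventually.of_forall ha) (h.hasDeriv a)

theorem exists_max (h : IsCnoidal lam mu w w') : ∃ a, ∀ x, w x ≤ w a := by
  obtain ⟨a, -, ha⟩ := isCompact_Icc.exists_isMaxOn (nonempty_Icc.2 (zero_le_one' ℝ))
    h.continuous.continuousOn
  refine ⟨a, fun x => ?_⟩
  obtain ⟨y, hy, hxy⟩ := h.periodic.exists_mem_Ico₀ one_pos x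
  rw [hxy]
  exact ha (Ico_subset_Icc_self hy)

theorem exists_min (h : IsCnoidal lam mu w w') : ∃ a, ∀ x, w a ≤ w x := by
  obtain ⟨a, -, ha⟩ := isCompact_Icc.exists_isMinOn (nonempty_Icc.2 (zero_le_one' ℝ))
    h.continuous.continuousOn
  refine ⟨a, fun x => ?_⟩
  obtain ⟨y, hy, hxy⟩ := h.periodic.exists_mem_Ico₀ one_pos x
  rw [hxy]
  exact ha (Ico_subset_Icc_self hy)

/-- A nonconstant cnoidal wave oscillates between the two largest roots of a real cubic. -/
theorem exists_roots (h : IsCnoidal lam mu w w') (hne : ∃ x y, w x ≠ w y) :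
    ∃ M m r, r < m ∧ m < M ∧ (∃ x, w x = M) ∧ (∃ x, w x = m) ∧ (∀ x, w x ≤ M) ∧ (∀ x, m ≤ w x) ∧
      lam = M + m + r ∧ ∀ x, w' x ^ 2 = (M - w x) * (w x - m) * (w x - r) := by
  obtain ⟨a, ha⟩ := h.exists_max
  obtain ⟨b, hb⟩ := h.exists_min
  obtain ⟨c, hc⟩ := h.exists_energy
  have ha' := h.deriv_eq_zero_of_max ha
  have hb' := h.deriv_eq_zero_of_min hb
  have hab : w b < w a := by
    obtain ⟨x, y, hxy⟩ := hne
    rcases lt_or_gt_of_ne hxy with hlt | hlt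
    · exact (hb x).trans_lt (hlt.trans_le (ha y))
    · exact (hb y).trans_lt (hlt.trans_le (ha x))
  have e1 := hc a
  have e2 := hc b
  rw [ha'] at e1
  rw [hb'] at e2
  set M := w a
  set m := w b
  have hmu : 2 * mu = M ^ 2 + M * m + m ^ 2 - lam * (M + m) := by
    have : (M - m) * (2 * mu - (M ^ 2 + M * m + m ^ 2 - lam * (M + m))) = 0 := by linarith
    rcases mul_eq_zero.1 this with h' | h' <;> linarith
  have hcc : c = M ^ 3 - lam * M ^ 2 - 2 * mu * M := by linarith
  have hfac : ∀ x, w' x ^ 2 = (M - w x) * (w x - m) * (w x - (lam - M - m)) := by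
    intro x
    rw [hc x, hcc, hmu]; ring
  have hrm : lam - M - m ≤ m := by
    by_contra! hlt
    obtain ⟨x, hx⟩ : ∃ x, w x = (m + min M (lam - M - m)) / 2 := by
      have := mem_range_of_exists_le_of_exists_ge h.continuous
        (c := (m + min M (lam - M - m)) / 2)
        ⟨b, by have := lt_min hab hlt; change m ≤ _; linarith⟩
        ⟨a, by have := min_le_left M (lam - M - m); change _ ≤ M; linarith⟩
      exact this
    have h1 := hfac x
    have h2 : m < w x := by rw [hx]; have := lt_min hab hlt; linarith
    have h3 : w x < M := by rw [hx]; have := min_le_left M (lam - M - m); linarith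
    have h4 : w x < lam - M - m := by
      rw [hx]; have := min_le_right M (lam - M - m); linarith
    have : 0 < (M - w x) * (w x - m) * ((lam - M - m) - w x) := by
      apply mul_pos (mul_pos _ _) <;> linarith
    nlinarith [sq_nonneg (w' x)]
  have hrne : lam - M - m ≠ m := by
    intro heq
    have hconst : IsCnoidal lam mu (fun _ => m) (fun _ => 0) :=
      { hasDeriv := fun x => hasDerivAt_const x m
        hasDeriv₂ := fun x => by
          have : -(3/2) * m ^ 2 + lam * m + mu = 0 := by
            have h1 : lam = M + 2 * m := by linarith
            have h2 := hmu
            rw [h1] at h2 ⊢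
            nlinarith
          rw [this]
          exact hasDerivAt_const x 0
        periodic := fun x => rfl }
    have := (h.translate b).ext hconst (by simp [m]) (by simp [hb'])
    have h3 := congrFun this.1 (a - b)
    simp only [sub_add_cancel] at h3
    exact hab.ne' h3
  exact ⟨M, m, lam - M - m, lt_of_le_of_ne hrm hrne, hab, ⟨a, rfl⟩, ⟨b, rfl⟩, ha, hb, by ring, hfac⟩

/-- A cnoidal wave with a crest at `0` either has a period at most `1/2`, or decreases from its
maximum to its minimum on `[0, 1/2]`. -/
theorem short_period_or_monotone (h : IsCnoidal lam mu w w') {M m r : ℝ} (hrm : r < m) (hmM : m < M)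
    (h0 : w 0 = M) (hM : ∀ x, w x ≤ M) (hm : ∀ x, m ≤ w x)
    (hfac : ∀ x, w' x ^ 2 = (M - w x) * (w x - m) * (w x - r)) :
    (∃ p, 0 < p ∧ p ≤ 1 / 2 ∧ Function.Periodic w p) ∨
      ((∀ x ∈ Ioo (0:ℝ) (1/2), w' x < 0) ∧ w (1/2) = m) := by
  have hcrit : ∀ x, w' x = 0 → w x = M ∨ w x = m := by
    intro x hx
    have h1 := hfac x
    rw [hx] at h1
    have h2 := hm x
    have h3 : (M - w x) * (w x - m) = 0 := by
      rcases mul_eq_zero.1 (show (M - w x) * (w x - m) * (w x - r) = 0 by rw [← h1]; norm_num)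
        with h' | h'
      · exact h'
      · linarith
    rcases mul_eq_zero.1 h3 with h' | h'
    · left; linarith
    · right; linarith
  have hcrest : ∀ x, w x = M → w' x = 0 := fun x hx =>
    h.deriv_eq_zero_of_max (fun y => by rw [hx]; exact hM y)
  by_cases hex : ∃ x ∈ Ioo (0:ℝ) 1, w x = M
  · left
    obtain ⟨x, hx, hxM⟩ := hex
    rcases le_total x (1/2) with hle | hle
    · refine ⟨x, hx.1, hle, ?_⟩
      simpa using h.periodic_of_eq (a := 0) (b := x) (by rw [h0, hxM])
        (by rw [hcrest 0 h0, hcrest x hxM])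
    · refine ⟨1 - x, by linarith [hx.2], by linarith, ?_⟩
      have h1 : w 1 = M := by rw [← h0]; simpa using h.periodic 0
      exact h.periodic_of_eq (a := x) (b := 1) (by rw [h1, hxM])
        (by rw [hcrest 1 h1, hcrest x hxM])
  · right
    push Not at hex
    have hhalf : w' (1/2) = 0 := by
      have hev : (fun x => w (1 - x)) = w := by
        funext x
        have h1 := h.even_about (hcrest 0 h0) x
        have h2 := h.periodic (-x)
        simp only [zero_add, zero_sub] at h1
        rw [h1, ← h2]; congr 1; ring
      have h1 : HasDerivAt (fun x => w (1 - x)) (-(w' (1 - 1/2))) (1/2) :=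
        ((h.hasDeriv (1 - 1/2)).comp (1/2) ((hasDerivAt_id (1/2:ℝ)).const_sub 1)).congr_deriv
          (by ring)
      rw [hev] at h1
      have h2 := h1.unique (h.hasDeriv (1/2))
      rw [show (1:ℝ) - 1/2 = 1/2 by norm_num] at h2
      linarith
    have hwhalf : w (1/2) = m := by
      rcases hcrit _ hhalf with h' | h'
      · exact absurd h' (hex _ ⟨by norm_num, by norm_num⟩)
      · exact h'
    have hne : ∀ x ∈ Ioo (0:ℝ) (1/2), w' x ≠ 0 := by
      intro x hx hx0
      have h1 := h.even_about hx0 x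
      simp only [sub_self] at h1
      exact hex (x + x) ⟨by linarith [hx.1], by linarith [hx.2]⟩ (by rw [h1, h0])
    obtain ⟨c, hc, hc'⟩ := exists_hasDerivAt_eq_slope w w' (show (0:ℝ) < 1/2 by norm_num)
      h.continuous.continuousOn (fun x _ => h.hasDeriv x)
    have hcneg : w' c < 0 := by
      rw [hc', hwhalf, h0]
      apply div_neg_of_neg_of_pos <;> linarith
    refine ⟨fun x hx => ?_, hwhalf⟩
    by_contra! hpos
    obtain ⟨y, hy, hy0⟩ := intermediate_value_uIcc (h.continuous_deriv.continuousOn (s := uIcc c x))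
      (show (0:ℝ) ∈ uIcc (w' c) (w' x) from mem_uIcc.2 (Or.inl ⟨hcneg.le, hpos⟩))
    have hy' : y ∈ Ioo (0:ℝ) (1/2) := (ordConnected_Ioo.uIcc_subset hc hx) hy
    exact hne y hy' hy0

end IsCnoidal

theorem cnoidal_phase_pos {M m r : ℝ} (hrm : r < m) (hmM : m < M) (φ : ℝ) :
    0 < (M + m) / 2 + (M - m) / 2 * cos φ - r := by
  nlinarith [neg_one_le_cos φ]

theorem continuous_inv_sqrt_phase {M m r : ℝ} (hrm : r < m) (hmM : m < M) :
    Continuous fun φ : ℝ => (√((M + m) / 2 + (M - m) / 2 * cos φ - r))⁻¹ := by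
  apply Continuous.inv₀ (by fun_prop)
  intro φ
  exact (sqrt_pos.2 (cnoidal_phase_pos hrm hmM φ)).ne.symm

/-- The half-period of a cnoidal wave as a complete elliptic integral. -/
theorem half_period_integral {z z' : ℝ → ℝ} {M m r : ℝ} (hrm : r < m) (hmM : m < M)
    (hd : ∀ x, HasDerivAt z (z' x) x) (h0 : z 0 = M) (h1 : z (1/2) = m)
    (hneg : ∀ x ∈ Ioo (0:ℝ) (1/2), z' x < 0) (hM : ∀ x, z x ≤ M) (hm : ∀ x, m ≤ z x)
    (hfac : ∀ x, z' x ^ 2 = (M - z x) * (z x - m) * (z x - r)) :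
    ∫ φ in (0:ℝ)..π, (√((M + m) / 2 + (M - m) / 2 * cos φ - r))⁻¹ = 1 / 2 := by
  set g : ℝ → ℝ := fun φ => (√((M + m) / 2 + (M - m) / 2 * cos φ - r))⁻¹ with hg
  have hgc : Continuous g := continuous_inv_sqrt_phase hrm hmM
  set L : ℝ → ℝ := fun t => ∫ φ in (0:ℝ)..t, g φ with hL
  have hLd : ∀ t, HasDerivAt L (g t) t := fun t => hgc.integral_hasStrictDerivAt 0 t |>.hasDerivAt
  set c : ℝ → ℝ := fun x => (2 * z x - M - m) / (M - m) with hc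
  have hMm : 0 < M - m := by linarith
  have hzc : Continuous z := continuous_iff_continuousAt.2 fun x => (hd x).continuousAt
  have hcont : Continuous fun x => L (arccos (c x)) := by
    have hLc : Continuous L := continuous_iff_continuousAt.2 fun x => (hLd x).continuousAt
    have hcc : Continuous c := by simp only [hc]; fun_prop
    exact hLc.comp (continuous_arccos.comp hcc)
  have hderiv : ∀ x ∈ Ioo (0:ℝ) (1/2), HasDerivAt (fun x => L (arccos (c x))) 1 x := by
    intro x hx
    have hz := hneg x hx
    have hsq := hfac x
    have hpos : 0 < z' x ^ 2 := by nlinarith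
    have hr : 0 < z x - r := by linarith [hm x]
    have a1 : 0 < M - z x := by
      rcases (sub_nonneg.2 (hM x)).eq_or_lt with h | h
      · rw [hsq, ← h] at hpos; simp at hpos
      · exact h
    have a2 : 0 < z x - m := by
      rcases (sub_nonneg.2 (hm x)).eq_or_lt with h | h
      · rw [hsq, ← h] at hpos; simp at hpos
      · exact h
    have hc1 : -1 < c x := by
      simp only [hc]; rw [lt_div_iff₀ hMm]; linarith
    have hc2 : c x < 1 := by
      simp only [hc]; rw [div_lt_iff₀ hMm]; linarith
    have hcd : HasDerivAt c (2 * z' x / (M - m)) x := by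
      have := ((((hd x).const_mul 2).sub_const M).sub_const m).div_const (M - m)
      exact this
    have hmain := (hLd (arccos (c x))).comp x ((hasDerivAt_arccos hc1.ne' hc2.ne).comp x hcd)
    refine hmain.congr_deriv ?_
    have hgv : g (arccos (c x)) = (√(z x - r))⁻¹ := by
      simp only [hg]
      rw [cos_arccos hc1.le hc2.le]
      congr 2
      simp only [hc]
      field_simp
      ring
    have h1c : 1 - c x ^ 2 = (2 / (M - m)) ^ 2 * ((M - z x) * (z x - m)) := by
      simp only [hc]; field_simp; ring
    have hz' : z' x = - (√((M - z x) * (z x - m)) * √(z x - r)) := by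
      rw [← sqrt_mul (by positivity), ← hsq, sqrt_sq_eq_abs, abs_of_neg hz, neg_neg]
    rw [hgv, h1c, sqrt_mul (by positivity), sqrt_sq (by positivity), hz']
    have b1 : 0 < √((M - z x) * (z x - m)) := sqrt_pos.2 (by positivity)
    have b2 : 0 < √(z x - r) := sqrt_pos.2 hr
    field_simp
  obtain ⟨x, hx, hslope⟩ := exists_hasDerivAt_eq_slope (fun x => L (arccos (c x))) (fun _ => 1)
    (show (0:ℝ) < 1/2 by norm_num) hcont.continuousOn hderiv
  have c0 : c 0 = 1 := by
    simp only [hc, h0]; rw [div_eq_one_iff_eq hMm.ne']; ring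
  have c1 : c (1/2) = -1 := by
    simp only [hc, h1]; rw [div_eq_iff hMm.ne']; ring
  simp only [c0, c1, arccos_one, arccos_neg_one] at hslope
  have L0 : L 0 = 0 := by simp [hL]
  rw [L0] at hslope
  change L π = 1 / 2
  field_simp at hslope
  linarith

theorem half_period_strictMono {M m r₁ r₂ : ℝ} (h12 : r₁ < r₂) (hrm : r₂ < m) (hmM : m < M) :
    ∫ φ in (0:ℝ)..π, (√((M + m) / 2 + (M - m) / 2 * cos φ - r₁))⁻¹ <
      ∫ φ in (0:ℝ)..π, (√((M + m) / 2 + (M - m) / 2 * cos φ - r₂))⁻¹ := by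
  have hlt : ∀ φ : ℝ, (√((M + m) / 2 + (M - m) / 2 * cos φ - r₁))⁻¹ <
      (√((M + m) / 2 + (M - m) / 2 * cos φ - r₂))⁻¹ := fun φ => by
    have := cnoidal_phase_pos hrm hmM φ
    gcongr
  exact integral_lt_integral_of_continuousOn_of_le_of_exists_lt pi_pos
    (continuous_inv_sqrt_phase (h12.trans hrm) hmM).continuousOn
    (continuous_inv_sqrt_phase hrm hmM).continuousOn
    (fun φ _ => (hlt φ).le) ⟨0, ⟨le_rfl, pi_pos.le⟩, hlt 0⟩

/-- A wave that decreases from a crest at `0` to a trough at `1/2`, together with the cubic that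
governs it. -/
structure IsSingleCrest (M m r : ℝ) (w w' : ℝ → ℝ) : Prop where
  lt₁ : r < m
  lt₂ : m < M
  crest : w 0 = M
  trough : w (1/2) = m
  le : ∀ x, w x ≤ M
  ge : ∀ x, m ≤ w x
  anti : ∀ x ∈ Ioo (0:ℝ) (1/2), w' x < 0
  energy : ∀ x, w' x ^ 2 = (M - w x) * (w x - m) * (w x - r)

/-- Single-crested cnoidal waves of period one are determined by their amplitude, up to an additive
constant. -/
theorem IsCnoidal.eq_of_amplitude {lam mu lam₂ mu₂ : ℝ} {w w' v v' : ℝ → ℝ} {M m r M₂ m₂ r₂ : ℝ}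
    (hw : IsCnoidal lam mu w w') (hv : IsCnoidal lam₂ mu₂ v v')
    (cw : IsSingleCrest M m r w w') (cv : IsSingleCrest M₂ m₂ r₂ v v')
    (hlam : lam = M + m + r) (hlam₂ : lam₂ = M₂ + m₂ + r₂)
    (hamp : M - m = M₂ - m₂) : ∀ x, w x = v x + (M - M₂) := by
  set b := M - M₂ with hb
  have hv2 := hv.add_const b
  have hMb : M₂ + b = M := by rw [hb]; ring
  have hmb : m₂ + b = m := by rw [hb]; linarith
  have cv2 : IsSingleCrest M m (r₂ + b) (fun x => v x + b) v' :=
    { lt₁ := by linarith [cv.lt₁]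
      lt₂ := cw.lt₂
      crest := by rw [cv.crest, hMb]
      trough := by rw [cv.trough, hmb]
      le := fun x => by linarith [cv.le x]
      ge := fun x => by linarith [cv.ge x]
      anti := cv.anti
      energy := fun x => by rw [cv.energy x, ← hMb, ← hmb]; ring }
  have i1 := half_period_integral cw.lt₁ cw.lt₂ hw.hasDeriv cw.crest cw.trough cw.anti cw.le cw.ge
    cw.energy
  have i2 := half_period_integral cv2.lt₁ cv2.lt₂ hv2.hasDeriv cv2.crest cv2.trough cv2.anti cv2.le
    cv2.ge cv2.energy
  have hr : r = r₂ + b := by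
    rcases lt_trichotomy r (r₂ + b) with h | h | h
    · have := half_period_strictMono h cv2.lt₁ cv2.lt₂
      linarith
    · exact h
    · have := half_period_strictMono h cw.lt₁ cw.lt₂
      linarith
  have hl : lam₂ + 3 * b = lam := by rw [hlam, hlam₂, hr, ← hMb, ← hmb]; ring
  have w0 : w' 0 = 0 := hw.deriv_eq_zero_of_max (fun x => by rw [cw.crest]; exact cw.le x)
  have v0 : v' 0 = 0 := hv.deriv_eq_zero_of_max (fun x => by rw [cv.crest]; exact cv.le x)
  have hmu : mu₂ - lam₂ * b - (3/2) * b ^ 2 = mu := by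
    have key : ∀ {l n : ℝ} {f f' : ℝ → ℝ} {R : ℝ}, IsCnoidal l n f f' → IsSingleCrest M m R f f' →
        l = M + m + R → 2 * n = M ^ 2 + M * m + m ^ 2 - l * (M + m) := by
      intro l n f f' R hf cf hl
      obtain ⟨c, hc⟩ := hf.exists_energy
      have f0 : f' 0 = 0 := hf.deriv_eq_zero_of_max (fun x => by rw [cf.crest]; exact cf.le x)
      have f1 : f' (1/2) = 0 := hf.deriv_eq_zero_of_min (fun x => by rw [cf.trough]; exact cf.ge x)
      have e1 := hc 0
      have e2 := hc (1/2)
      rw [f0, cf.crest] at e1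
      rw [f1, cf.trough] at e2
      have hMm : M - m ≠ 0 := by linarith [cf.lt₂]
      have : (M - m) * (2 * n - (M ^ 2 + M * m + m ^ 2 - l * (M + m))) = 0 := by linarith
      rcases mul_eq_zero.1 this with h' | h'
      · exact absurd h' hMm
      · linarith
    have k1 := key hw cw hlam
    have k2 := key hv2 cv2 (by rw [hl, hlam, hr])
    rw [hl] at k2
    linarith
  rw [hl, hmu] at hv2
  have := (hw.ext hv2 (by rw [cw.crest, cv.crest, hMb]) (by rw [w0, v0])).1
  intro x
  exact congrFun this x

/-- The square of the hyperbolic secant. -/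
noncomputable def sechSq (x : ℝ) : ℝ := (cosh x ^ 2)⁻¹

theorem sechSq_pos (x : ℝ) : 0 < sechSq x := inv_pos.2 (pow_pos (cosh_pos x) 2)

theorem sechSq_neg (x : ℝ) : sechSq (-x) = sechSq x := by simp [sechSq]

theorem sechSq_zero : sechSq 0 = 1 := by simp [sechSq]

theorem sechSq_eq (x : ℝ) : sechSq x = 1 - tanh x ^ 2 := by
  have := cosh_sq x
  have h := (cosh_pos x).ne'
  rw [sechSq, tanh_eq_sinh_div_cosh]
  field_simp
  linarith

theorem sechSq_le_one (x : ℝ) : sechSq x ≤ 1 := by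
  rw [sechSq_eq]; nlinarith [sq_nonneg (tanh x)]

theorem hasDerivAt_tanh' (x : ℝ) : HasDerivAt tanh (sechSq x) x := by
  have h := (cosh_pos x).ne'
  have h1 := (hasDerivAt_sinh x).div (hasDerivAt_cosh x) h
  have h2 : tanh = fun x => sinh x / cosh x := funext tanh_eq_sinh_div_cosh
  rw [h2]
  refine h1.congr_deriv ?_
  rw [sechSq, ← one_div]
  congr 1
  nlinarith [cosh_sq x]

theorem hasDerivAt_sechSq (x : ℝ) : HasDerivAt sechSq (-2 * tanh x * sechSq x) x := by
  have h1 : sechSq = fun x => 1 - tanh x ^ 2 := funext sechSq_eq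
  have h2 := ((hasDerivAt_tanh' x).pow 2).const_sub 1
  conv => arg 1; rw [h1]
  refine h2.congr_deriv ?_
  push_cast
  ring

theorem hasDerivAt_deriv_sechSq (x : ℝ) :
    HasDerivAt (fun x => -2 * tanh x * sechSq x) (4 * sechSq x - 6 * sechSq x ^ 2) x := by
  have h2 := ((hasDerivAt_tanh' x).const_mul (-2)).mul (hasDerivAt_sechSq x)
  refine h2.congr_deriv ?_
  have := sechSq_eq x
  linear_combination (4 * sechSq x) * this

theorem sechSq_le_exp (x : ℝ) : sechSq x ≤ 4 * exp (-2 * |x|) := by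
  have h1 : exp |x| / 2 ≤ cosh x := by
    rw [← cosh_abs, cosh_eq]; have := exp_pos (-|x|); linarith
  have h2 : (exp |x| / 2) ^ 2 ≤ cosh x ^ 2 := by gcongr
  calc sechSq x ≤ ((exp |x| / 2) ^ 2)⁻¹ := by
        rw [sechSq]; gcongr
    _ = 4 * exp (-2 * |x|) := by
        rw [show -2 * |x| = -(|x| + |x|) by ring, exp_neg, exp_add]
        field_simp
        norm_num

theorem abs_deriv_sechSq_le_exp (x : ℝ) : |-2 * tanh x * sechSq x| ≤ 8 * exp (-2 * |x|) := by
  rw [abs_mul, abs_mul, abs_of_pos (sechSq_pos x)]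
  have h1 := (abs_tanh_lt_one x).le
  have h2 := sechSq_le_exp x
  have h3 := sechSq_pos x
  rw [show |(-2 : ℝ)| = 2 by norm_num]
  nlinarith [mul_le_of_le_one_left h3.le h1]

theorem abs_deriv₂_sechSq_le_exp (x : ℝ) :
    |4 * sechSq x - 6 * sechSq x ^ 2| ≤ 16 * exp (-2 * |x|) := by
  have h1 := sechSq_le_one x
  have h2 := sechSq_le_exp x
  have h3 := sechSq_pos x
  rw [abs_le]; constructor <;> nlinarith

theorem one_sub_tanh_le (x : ℝ) : 1 - tanh x ≤ 2 * exp (-2 * x) := by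
  rw [tanh_eq, show -2 * x = -x + -x by ring, exp_add]
  have h1 := exp_pos x
  have h2 := exp_pos (-x)
  have h3 : exp x * exp (-x) = 1 := by rw [← exp_add]; simp
  rw [sub_le_iff_le_add, ← sub_le_iff_le_add', le_div_iff₀ (by positivity)]
  nlinarith [mul_pos h2 h2, mul_pos (mul_pos h2 h2) h2]

theorem tendsto_tanh_atTop : Filter.Tendsto tanh Filter.atTop (nhds 1) := by
  have h : Filter.Tendsto (fun x : ℝ => 1 - 2 * exp (-2 * x)) Filter.atTop (nhds (1 - 2 * 0)) := by
    refine (Filter.Tendsto.const_mul 2 ?_).const_sub 1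
    exact tendsto_exp_atBot.comp (Filter.tendsto_id.const_mul_atTop_of_neg (by norm_num))
  rw [mul_zero, sub_zero] at h
  exact tendsto_of_tendsto_of_tendsto_of_le_of_le h tendsto_const_nhds
    (fun x => by linarith [one_sub_tanh_le x]) (fun x => (tanh_lt_one x).le)

theorem tendsto_tanh_atBot : Filter.Tendsto tanh Filter.atBot (nhds (-1)) := by
  have := (tendsto_tanh_atTop.comp Filter.tendsto_neg_atBot_atTop).neg
  refine this.congr fun x => ?_
  simp

theorem tanh_strictMono : StrictMono tanh :=
  strictMono_of_deriv_pos fun x => by rw [(hasDerivAt_tanh' x).deriv]; exact sechSq_pos x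

/-- The partial fraction decomposition of a product of two shifted copies of `sechSq`. -/
theorem sechSq_mul_sechSq {a b : ℝ} (hab : a - b ≠ 0) :
    sechSq a * sechSq b = 2 * cosh (a - b) / sinh (a - b) ^ 3 * (tanh a - tanh b)
      - (sinh (a - b) ^ 2)⁻¹ * (sechSq a + sechSq b) := by
  have hs : sinh (a - b) ≠ 0 := fun h => hab (sinh_eq_zero.1 h)
  have ha := (cosh_pos a).ne'
  have hb := (cosh_pos b).ne'
  have h1 : tanh a - tanh b = sinh (a - b) * (cosh a * cosh b)⁻¹ := by
    rw [tanh_eq_sinh_div_cosh, tanh_eq_sinh_div_cosh, sinh_sub]; field_simp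
  rw [h1, sechSq, sechSq]
  field_simp
  have ea := cosh_sq a
  have eb := cosh_sq b
  rw [sinh_sub, cosh_sub]
  have ea' : sinh a ^ 2 = cosh a ^ 2 - 1 := by linarith
  have eb' : sinh b ^ 2 = cosh b ^ 2 - 1 := by linarith
  ring_nf
  try rw [ea', eb']
  ring_nf

/-- Telescoping sums over the integers. -/
theorem hasSum_int_telescope {f : ℤ → ℝ} (hf : Antitone f) {a b : ℝ}
    (ha : Filter.Tendsto f Filter.atBot (nhds a)) (hb : Filter.Tendsto f Filter.atTop (nhds b)) :
    HasSum (fun n => f n - f (n + 1)) (a - b) := by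
  have h1 : HasSum (fun n : ℕ => f n - f (n + 1)) (f 0 - b) := by
    rw [hasSum_iff_tendsto_nat_of_nonneg (fun i => sub_nonneg.2 (hf (by lia)))]
    have : ∀ n : ℕ, ∑ i ∈ Finset.range n, (f i - f (i + 1)) = f 0 - f n := fun n => by
      have := Finset.sum_range_sub' (fun i : ℕ => f i) n
      simpa using this
    simp_rw [this]
    exact (hb.comp tendsto_natCast_atTop_atTop).const_sub _
  have h2 : HasSum (fun n : ℕ => f (-(n + 1)) - f (-(n + 1) + 1)) (a - f 0) := by
    rw [hasSum_iff_tendsto_nat_of_nonneg (fun i => sub_nonneg.2 (hf (by lia)))]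
    have : ∀ n : ℕ, ∑ i ∈ Finset.range n, (f (-(i + 1)) - f (-(i + 1) + 1)) = f (-n) - f 0 :=
      fun n => by
      have := Finset.sum_range_sub (fun i : ℕ => f (-i)) n
      simp only [Nat.cast_add, Nat.cast_one, Nat.cast_zero, neg_zero] at this
      rw [← this]
      refine Finset.sum_congr rfl fun i _ => ?_
      congr 2; ring
    simp_rw [this]
    refine (ha.comp ?_).sub_const _
    exact Filter.tendsto_neg_atTop_atBot.comp tendsto_natCast_atTop_atTop
  have h3 := HasSum.of_nat_of_neg_add_one (f := fun n => f n - f (n + 1)) h1 h2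
  convert h3 using 1
  ring

theorem hasSum_int_telescope_shift {f : ℤ → ℝ} (hf : Antitone f) {a b : ℝ}
    (ha : Filter.Tendsto f Filter.atBot (nhds a)) (hb : Filter.Tendsto f Filter.atTop (nhds b))
    (j : ℕ) : HasSum (fun n => f n - f (n + j)) (j * (a - b)) := by
  induction j with
  | zero => simp
  | succ j ih =>
    have h1 := (Equiv.addRight (j : ℤ)).hasSum_iff.2 (hasSum_int_telescope hf ha hb)
    convert ih.add h1 using 1
    · funext n
      simp [add_assoc]
    · push_cast; ring

theorem HasSum.congr_terms {ι : Type*} {f g : ι → ℝ} {a : ℝ} (h : HasSum f a)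
    (e : ∀ i, g i = f i) : HasSum g a := (funext e : g = f) ▸ h

theorem summable_exp_neg_mul_abs_int {a : ℝ} (ha : 0 < a) :
    Summable fun n : ℤ => exp (-a * |(n : ℝ)|) := by
  have h : Summable fun n : ℕ => exp (-a * n) := by
    have := summable_geometric_of_lt_one (exp_pos (-a)).le (exp_lt_one_iff.2 (neg_lt_zero.2 ha))
    refine this.congr fun n => ?_
    rw [← exp_nat_mul, mul_comm]
  refine Summable.of_nat_of_neg ?_ ?_
  · simpa using h
  · simpa using h

theorem exp_lattice_le {k B x : ℝ} (hk : 0 < k) (hx : |x| ≤ B) (n : ℤ) :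
    exp (-2 * |k * (x - n)|) ≤ exp (2 * k * B) * exp (-(2 * k) * |(n : ℝ)|) := by
  rw [← exp_add]
  apply exp_le_exp.2
  rw [abs_mul, abs_of_pos hk]
  have : |(n : ℝ)| ≤ |x - n| + |x| := by
    have := abs_sub_abs_le_abs_sub (n : ℝ) x
    rw [abs_sub_comm] at this
    linarith
  nlinarith

theorem summable_lattice {f : ℝ → ℝ} {C k : ℝ} (hk : 0 < k)
    (hf : ∀ x, |f x| ≤ C * exp (-2 * |x|)) (x : ℝ) : Summable fun n : ℤ => f (k * (x - n)) := by
  have hC : 0 ≤ C := by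
    have := (abs_nonneg _).trans (hf 0); simpa using this
  refine Summable.of_norm_bounded (g := fun n : ℤ =>
    C * (exp (2 * k * |x|) * exp (-(2 * k) * |(n : ℝ)|))) ?_ fun n => ?_
  · exact ((summable_exp_neg_mul_abs_int (by positivity)).mul_left _).mul_left _
  · exact (hf _).trans (mul_le_mul_of_nonneg_left (exp_lattice_le hk le_rfl n) hC)

theorem hasDerivAt_tsum_lattice {f f' : ℝ → ℝ} {C k : ℝ} (hk : 0 < k)
    (hd : ∀ x, HasDerivAt f (f' x) x) (hb : ∀ x, |f' x| ≤ C * exp (-2 * |x|)) (c : ℤ → ℝ)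
    {x₀ : ℝ} (hs : Summable fun n : ℤ => f (k * (x₀ - n)) - c n) (x : ℝ) :
    HasDerivAt (fun x => ∑' n : ℤ, (f (k * (x - n)) - c n)) (k * ∑' n : ℤ, f' (k * (x - n))) x := by
  have hC : 0 ≤ C := by
    have := (abs_nonneg _).trans (hb 0); simpa using this
  set B := max |x| |x₀| + 1
  have hxB : x ∈ Ioo (-B) B := abs_lt.1 (by have := le_max_left |x| |x₀|; linarith)
  have hx0B : x₀ ∈ Ioo (-B) B := abs_lt.1 (by have := le_max_right |x| |x₀|; linarith)
  rw [← tsum_mul_left]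
  refine hasDerivAt_tsum_of_isPreconnected (u := fun n : ℤ =>
    k * (C * (exp (2 * k * B) * exp (-(2 * k) * |(n : ℝ)|)))) ?_ isOpen_Ioo isPreconnected_Ioo
    (g' := fun n y => k * f' (k * (y - n))) ?_ ?_ hx0B hs hxB
  · exact (((summable_exp_neg_mul_abs_int (by positivity)).mul_left _).mul_left _).mul_left _
  · intro n y _
    have h1 : HasDerivAt (fun y : ℝ => k * (y - n)) k y :=
      (((hasDerivAt_id y).sub_const _).const_mul k).congr_deriv (by simp)
    exact (((hd _).comp y h1).sub_const _).congr_deriv (by ring)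
  · intro n y hy
    rw [norm_mul, Real.norm_of_nonneg hk.le]
    refine mul_le_mul_of_nonneg_left ?_ hk.le
    exact (hb _).trans (mul_le_mul_of_nonneg_left
      (exp_lattice_le hk (abs_lt.2 hy).le n) hC)

/-- The periodization of `sechSq (k * x)`. -/
noncomputable def sechSum (k x : ℝ) : ℝ := ∑' n : ℤ, sechSq (k * (x - n))

/-- The derivative of `sechSum` in space. -/
noncomputable def sechSum' (k x : ℝ) : ℝ :=
  k * ∑' n : ℤ, -2 * tanh (k * (x - n)) * sechSq (k * (x - n))

/-- The lattice sum of `1 / sinh²`. -/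
noncomputable def cschSum (k : ℝ) : ℝ := ∑' j : ℕ, (sinh (k * (j + 1)) ^ 2)⁻¹

/-- The lattice sum of `j * cosh / sinh³`. -/
noncomputable def cothSum (k : ℝ) : ℝ :=
  ∑' j : ℕ, (j + 1) * (cosh (k * (j + 1)) / sinh (k * (j + 1)) ^ 3)

theorem summable_sechSq {k : ℝ} (hk : 0 < k) (x : ℝ) :
    Summable fun n : ℤ => sechSq (k * (x - n)) :=
  summable_lattice hk (C := 4) (fun x => by
    rw [abs_of_pos (sechSq_pos x)]; exact sechSq_le_exp x) x

theorem summable_deriv_sechSq {k : ℝ} (hk : 0 < k) (x : ℝ) :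
    Summable fun n : ℤ => -2 * tanh (k * (x - n)) * sechSq (k * (x - n)) :=
  summable_lattice (f := fun x => -2 * tanh x * sechSq x) hk (C := 8) abs_deriv_sechSq_le_exp x

theorem hasDerivAt_sechSum {k : ℝ} (hk : 0 < k) (x : ℝ) :
    HasDerivAt (sechSum k) (sechSum' k x) x := by
  have := hasDerivAt_tsum_lattice hk hasDerivAt_sechSq abs_deriv_sechSq_le_exp (fun _ => 0)
    (x₀ := 0) (by simpa using summable_sechSq hk 0) x
  simp only [sub_zero] at this
  exact this

theorem summable_sechSq_sq {k : ℝ} (hk : 0 < k) (x : ℝ) :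
    Summable fun n : ℤ => sechSq (k * (x - n)) ^ 2 :=
  (summable_sechSq hk x).of_nonneg_of_le (fun _ => sq_nonneg _) fun n => by
    have h1 := sechSq_le_one (k * (x - n))
    have h2 := sechSq_pos (k * (x - n))
    nlinarith

theorem hasDerivAt_sechSum' {k : ℝ} (hk : 0 < k) (x : ℝ) :
    HasDerivAt (sechSum' k)
      (k ^ 2 * (4 * sechSum k x - 6 * ∑' n : ℤ, sechSq (k * (x - n)) ^ 2)) x := by
  have := (hasDerivAt_tsum_lattice hk hasDerivAt_deriv_sechSq abs_deriv₂_sechSq_le_exp (fun _ => 0)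
    (x₀ := 0) (by simpa only [sub_zero] using summable_deriv_sechSq hk 0) x).const_mul k
  simp only [sub_zero] at this
  refine this.congr_deriv ?_
  rw [((summable_sechSq hk x).mul_left 4).tsum_sub ((summable_sechSq_sq hk x).mul_left 6),
    tsum_mul_left, tsum_mul_left, sechSum]
  ring

theorem summable_cschSum {k : ℝ} (hk : 0 < k) :
    Summable fun j : ℕ => (sinh (k * (j + 1)) ^ 2)⁻¹ := by
  have h : Summable fun j : ℕ => (k ^ 2)⁻¹ * (((j + 1 : ℕ) : ℝ) ^ 2)⁻¹ :=
    ((summable_nat_add_iff 1).2 (Real.summable_nat_pow_inv.2 one_lt_two)).mul_left _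
  refine h.of_nonneg_of_le (fun j => by positivity) fun j => ?_
  rw [← mul_inv, ← mul_pow]
  push_cast
  have : k * (j + 1) ≤ sinh (k * (j + 1)) := self_le_sinh_iff.2 (by positivity)
  gcongr

theorem sechSq_lattice_pair {k : ℝ} (hk : 0 < k) (x : ℝ) (j : ℕ) :
    HasSum (fun n : ℤ => sechSq (k * (x - n)) * sechSq (k * (x - (n + (j + 1 : ℕ) : ℤ))))
      (4 * ((j + 1) * (cosh (k * (j + 1)) / sinh (k * (j + 1)) ^ 3)) -
        2 * sechSum k x * (sinh (k * (j + 1)) ^ 2)⁻¹) := by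
  set s : ℤ → ℝ := fun n => sechSq (k * (x - n)) with hs
  have h1 : HasSum s (sechSum k x) := (summable_sechSq hk x).hasSum
  obtain ⟨i, hi⟩ : ∃ i : ℤ, i = ((j + 1 : ℕ) : ℤ) := ⟨_, rfl⟩
  have hi' : ((i : ℤ) : ℝ) = j + 1 := by rw [hi]; push_cast; rfl
  have h2 : HasSum (fun n : ℤ => s (n + i)) (sechSum k x) := (Equiv.addRight i).hasSum_iff.2 h1
  rw [← hi]
  set t : ℤ → ℝ := fun n => tanh (k * (x - n)) with ht
  have ht_anti : Antitone t := fun m n hmn => by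
    apply tanh_strictMono.monotone
    have : (m : ℝ) ≤ n := by exact_mod_cast hmn
    gcongr
  have htop : Filter.Tendsto (fun n : ℤ => k * (x - n)) Filter.atTop Filter.atBot := by
    apply Filter.Tendsto.const_mul_atBot hk
    exact Filter.tendsto_atBot_add_const_left _ x
      (Filter.tendsto_neg_atTop_atBot.comp tendsto_intCast_atTop_atTop)
  have hbot : Filter.Tendsto (fun n : ℤ => k * (x - n)) Filter.atBot Filter.atTop := by
    apply Filter.Tendsto.const_mul_atTop hk
    refine Filter.tendsto_atTop_add_const_left _ x
      (Filter.tendsto_neg_atBot_atTop.comp ?_)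
    exact tendsto_intCast_atBot_iff.2 Filter.tendsto_id
  have h3 := hasSum_int_telescope_shift ht_anti (tendsto_tanh_atTop.comp hbot)
    (tendsto_tanh_atBot.comp htop) (j + 1)
  rw [← hi] at h3
  have h4 := (h3.mul_left (2 * cosh (k * (j + 1)) / sinh (k * (j + 1)) ^ 3)).sub
    ((h1.add h2).mul_left (sinh (k * (j + 1)) ^ 2)⁻¹)
  have hval : 4 * ((j + 1) * (cosh (k * (j + 1)) / sinh (k * (j + 1)) ^ 3)) -
      2 * sechSum k x * (sinh (k * (j + 1)) ^ 2)⁻¹ =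
      2 * cosh (k * (j + 1)) / sinh (k * (j + 1)) ^ 3 * (((j + 1 : ℕ) : ℝ) * (1 - -1)) -
      (sinh (k * (j + 1)) ^ 2)⁻¹ * (sechSum k x + sechSum k x) := by
    push_cast; ring
  rw [hval]
  refine h4.congr_terms fun n => ?_
  · have hab : k * (x - n) - k * (x - (n + i : ℤ)) = k * (j + 1) := by
      push_cast; rw [hi']; ring
    have := sechSq_mul_sechSq (a := k * (x - n)) (b := k * (x - (n + i : ℤ)))
      (by rw [hab]; positivity)
    rw [hab] at this
    exact this

theorem hasSum_sechSum_sq {k : ℝ} (hk : 0 < k) (x : ℝ) :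
    HasSum (fun j : ℕ => 8 * ((j + 1) * (cosh (k * (j + 1)) / sinh (k * (j + 1)) ^ 3)) -
        4 * sechSum k x * (sinh (k * (j + 1)) ^ 2)⁻¹)
      (sechSum k x ^ 2 - ∑' n : ℤ, sechSq (k * (x - n)) ^ 2) := by
  set s : ℤ → ℝ := fun n => sechSq (k * (x - n)) with hs
  have h1 : HasSum s (sechSum k x) := (summable_sechSq hk x).hasSum
  have hs0 : 0 ≤ s := fun n => (sechSq_pos _).le
  have h2 := h1.mul h1 (h1.summable.mul_of_nonneg h1.summable hs0 hs0)
  let e : ℤ × ℤ ≃ ℤ × ℤ :=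
    { toFun := fun p => (p.2, p.2 + p.1)
      invFun := fun p => (p.2 - p.1, p.1)
      left_inv := fun p => by simp
      right_inv := fun p => by simp }
  have h3 := e.hasSum_iff.2 h2
  have h4 := h3.prod_fiberwise (fun j => (h3.summable.prod_factor j).hasSum)
  set c : ℤ → ℝ := fun j => ∑' n, s n * s (n + j) with hc
  change HasSum c _ at h4
  have hneg : ∀ j, c (-j) = c j := fun j => by
    have := (Equiv.addRight j).tsum_eq fun n => s n * s (n + -j)
    simp only [Equiv.coe_addRight, add_neg_cancel_right] at this
    rw [hc]
    simp only
    rw [← this]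
    exact tsum_congr fun n => mul_comm _ _
  have h5 := h4.nat_add_neg
  simp only [hneg] at h5
  have h6 := (hasSum_nat_add_iff' 1).2 h5
  have hc0 : c 0 = ∑' n : ℤ, s n ^ 2 := tsum_congr fun n => by simp [sq]
  have hcj : ∀ j : ℕ, c ((j + 1 : ℕ) : ℤ) = (4 * ((j + 1) * (cosh (k * (j + 1)) /
      sinh (k * (j + 1)) ^ 3)) - 2 * sechSum k x * (sinh (k * (j + 1)) ^ 2)⁻¹) :=
    fun j => (sechSq_lattice_pair hk x j).tsum_eq
  have hval : sechSum k x ^ 2 - ∑' n : ℤ, s n ^ 2 =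
      sechSum k x * sechSum k x + c 0 - ∑ i ∈ Finset.range 1, (c i + c i) := by
    rw [Finset.sum_range_one, ← hc0, Nat.cast_zero]; ring
  rw [hval]
  refine h6.congr_terms fun j => ?_
  rw [hcj]
  ring

theorem summable_cothSum {k : ℝ} (hk : 0 < k) :
    Summable fun j : ℕ => (j + 1) * (cosh (k * (j + 1)) / sinh (k * (j + 1)) ^ 3) := by
  have h := ((hasSum_sechSum_sq hk 0).summable.add
    ((summable_cschSum hk).mul_left (4 * sechSum k 0))).mul_left (1 / 8)
  refine h.congr fun j => ?_
  ring

theorem sechSum_sq {k : ℝ} (hk : 0 < k) (x : ℝ) :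
    ∑' n : ℤ, sechSq (k * (x - n)) ^ 2 =
      sechSum k x ^ 2 - 8 * cothSum k + 4 * sechSum k x * cschSum k := by
  have h1 := (hasSum_sechSum_sq hk x).unique
    (((summable_cothSum hk).hasSum.mul_left 8).sub ((summable_cschSum hk).hasSum.mul_left _))
  rw [cothSum, cschSum]
  linarith

theorem sechSum_periodic (k : ℝ) : Function.Periodic (sechSum k) 1 := fun x => by
  have := (Equiv.addRight (1:ℤ)).tsum_eq fun n : ℤ => sechSq (k * (x + 1 - n))
  rw [sechSum, ← this, sechSum]
  refine tsum_congr fun n => ?_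
  simp only [Equiv.coe_addRight]
  push_cast
  congr 2; ring

theorem sechSum_neg (k x : ℝ) : sechSum k (-x) = sechSum k x := by
  have := (Equiv.neg ℤ).tsum_eq fun n : ℤ => sechSq (k * (-x - n))
  rw [sechSum, ← this, sechSum]
  refine tsum_congr fun n => ?_
  simp only [Equiv.neg_apply]
  push_cast
  rw [← sechSq_neg]
  congr 1; ring

/-- The cnoidal wave obtained by superposing solitary waves. -/
theorem isCnoidal_sechSum {k : ℝ} (hk : 0 < k) :
    IsCnoidal (4 * k ^ 2 - 24 * k ^ 2 * cschSum k) (192 * k ^ 4 * cothSum k)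
      (fun x => 4 * k ^ 2 * sechSum k x) (fun x => 4 * k ^ 2 * sechSum' k x) where
  hasDeriv x := (hasDerivAt_sechSum hk x).const_mul _
  hasDeriv₂ x := by
    refine ((hasDerivAt_sechSum' hk x).const_mul (4 * k ^ 2)).congr_deriv ?_
    rw [sechSum_sq hk]
    ring
  periodic x := by
    change 4 * k ^ 2 * sechSum k (x + 1) = _
    rw [sechSum_periodic]

theorem continuous_sechSum {k : ℝ} (hk : 0 < k) : Continuous (sechSum k) :=
  continuous_iff_continuousAt.2 fun x => (hasDerivAt_sechSum hk x).continuousAt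

theorem integral_sechSum {k : ℝ} (hk : 0 < k) : ∫ x in (0:ℝ)..1, sechSum k x = 2 / k := by
  have hb : ∀ x, |sechSq x| ≤ 4 * exp (-2 * |x|) := fun x => by
    rw [abs_of_pos (sechSq_pos x)]; exact sechSq_le_exp x
  have hd := hasDerivAt_tsum_lattice hk hasDerivAt_tanh' hb (fun n : ℤ => tanh (k * (0 - n)))
    (x₀ := 0) (by simp)
  have hFTC := integral_eq_sub_of_hasDerivAt (a := 0) (b := 1) (fun x _ => hd x)
    (((continuous_sechSum hk).const_mul k).intervalIntegrable _ _)
  have ht_anti : Antitone fun n : ℤ => tanh (k * (1 - n)) := fun m n hmn => by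
    apply tanh_strictMono.monotone
    have : (m : ℝ) ≤ n := by exact_mod_cast hmn
    gcongr
  have htop : Filter.Tendsto (fun n : ℤ => k * (1 - n)) Filter.atTop Filter.atBot := by
    apply Filter.Tendsto.const_mul_atBot hk
    exact Filter.tendsto_atBot_add_const_left _ 1
      (Filter.tendsto_neg_atTop_atBot.comp tendsto_intCast_atTop_atTop)
  have hbot : Filter.Tendsto (fun n : ℤ => k * (1 - n)) Filter.atBot Filter.atTop := by
    apply Filter.Tendsto.const_mul_atTop hk
    refine Filter.tendsto_atTop_add_const_left _ 1
      (Filter.tendsto_neg_atBot_atTop.comp ?_)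
    exact tendsto_intCast_atBot_iff.2 Filter.tendsto_id
  have hT := hasSum_int_telescope ht_anti (tendsto_tanh_atTop.comp hbot)
    (tendsto_tanh_atBot.comp htop)
  have hT' : ∑' n : ℤ, (tanh (k * (1 - n)) - tanh (k * (0 - n))) = 1 - -1 := by
    rw [← hT.tsum_eq]
    refine tsum_congr fun n => ?_
    push_cast
    congr 3; ring
  rw [hT'] at hFTC
  simp only [sub_self, tsum_zero] at hFTC
  have : ∫ x in (0:ℝ)..1, k * sechSum k x = 2 := by
    rw [show (2:ℝ) = 1 - -1 - 0 by norm_num]; exact hFTC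
  rw [intervalIntegral.integral_const_mul] at this
  rw [eq_div_iff hk.ne']; linarith

theorem hasSum_inv_succ_sq : HasSum (fun j : ℕ => (((j : ℝ) + 1) ^ 2)⁻¹) (π ^ 2 / 6) := by
  have := (hasSum_nat_add_iff' 1).2 hasSum_zeta_two
  simpa using this

theorem tsum_inv_succ_sq_le : ∑' j : ℕ, (((j : ℝ) + 1) ^ 2)⁻¹ ≤ 2 := by
  rw [hasSum_inv_succ_sq.tsum_eq]
  nlinarith [pi_lt_d2, pi_pos]

theorem cschSum_nonneg (k : ℝ) : 0 ≤ cschSum k := tsum_nonneg fun _ => by positivity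

theorem sq_mul_cschSum_le {k : ℝ} (hk : 0 < k) : k ^ 2 * cschSum k ≤ 2 := by
  rw [cschSum, ← tsum_mul_left]
  refine le_trans (Summable.tsum_le_tsum (fun j => ?_) ((summable_cschSum hk).mul_left _)
    hasSum_inv_succ_sq.summable) tsum_inv_succ_sq_le
  have : k * (j + 1) ≤ sinh (k * (j + 1)) := self_le_sinh_iff.2 (by positivity)
  have h2 : k ^ 2 * ((j:ℝ) + 1) ^ 2 ≤ sinh (k * (j + 1)) ^ 2 := by
    rw [← mul_pow]; gcongr
  have h3 : 0 < k * ((j:ℝ) + 1) := by positivity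
  have h4 : 0 < sinh (k * (j + 1)) := h3.trans_le this
  rw [← one_div, ← one_div, mul_one_div, div_le_div_iff₀ (by positivity) (by positivity)]
  linarith

theorem exp_neg_two_le : exp (-2) ≤ 1 / 5 := by
  have h : (5:ℝ) ≤ exp 2 := by
    have := quadratic_le_exp_of_nonneg (x := 2) (by norm_num)
    linarith
  rw [exp_neg, ← one_div]
  exact one_div_le_one_div_of_le (by norm_num) h

theorem sechSum_sub_mem {k x : ℝ} (hk : 1 ≤ k) (hx : |x| ≤ 1 / 2) :
    0 ≤ sechSum k x - sechSq (k * x) ∧ sechSum k x - sechSq (k * x) ≤ 10 * exp (-k) := by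
  have hk0 : 0 < k := by linarith
  have h1 : HasSum (fun n : ℤ => sechSq (k * (x - n))) (sechSum k x) := (summable_sechSq hk0 x).hasSum
  have h2 := (hasSum_nat_add_iff' 1).2 h1.nat_add_neg
  have h0 : sechSum k x + sechSq (k * (x - ((0:ℤ):ℝ))) - ∑ i ∈ Finset.range 1,
      (sechSq (k * (x - ((i:ℤ):ℝ))) + sechSq (k * (x - ((-(i:ℤ):ℤ):ℝ)))) =
      sechSum k x - sechSq (k * x) := by
    rw [Finset.sum_range_one]
    simp
  rw [h0] at h2
  have hr : exp (-2 * k) ≤ 1 / 5 := (exp_le_exp.2 (by linarith)).trans exp_neg_two_le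
  have hgeo := hasSum_geometric_of_lt_one (exp_pos (-2 * k)).le (by linarith)
  refine ⟨h2.nonneg fun n => (add_pos (sechSq_pos _) (sechSq_pos _)).le, ?_⟩
  have hle := hasSum_le (fun n => ?_) h2 (hgeo.mul_left (8 * exp (-k)))
  · refine hle.trans ?_
    have : (1 - exp (-2 * k))⁻¹ ≤ 5 / 4 := by
      rw [← one_div, div_le_iff₀ (by linarith)]; linarith
    have := exp_pos (-k)
    nlinarith
  · have hb : ∀ y : ℝ, (n:ℝ) + 1 / 2 ≤ |y| → sechSq (k * y) ≤ 4 * exp (-k) * exp (-2 * k) ^ n := by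
      intro y hy
      refine (sechSq_le_exp _).trans ?_
      rw [mul_assoc, ← exp_nat_mul, ← exp_add, abs_mul, abs_of_pos hk0]
      have : -2 * (k * |y|) ≤ -k + n * (-2 * k) := by nlinarith
      gcongr
    obtain ⟨hx1, hx2⟩ := abs_le.1 hx
    have e1 := hb (x - (((n + 1 : ℕ):ℤ):ℝ)) (by
      push_cast
      rw [abs_sub_comm]
      exact le_trans (by linarith) (le_abs_self _))
    have e2 := hb (x - ((-((n + 1 : ℕ):ℤ):ℤ):ℝ)) (by
      push_cast
      exact le_trans (by linarith) (le_abs_self _))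
    linarith

theorem continuousOn_sechSum_left (x : ℝ) : ContinuousOn (fun k => sechSum k x) (Ici 1) := by
  refine continuousOn_tsum (u := fun n : ℤ => 4 * (exp (2 * 1 * |x|) * exp (-(2 * 1) * |(n : ℝ)|)))
    (fun n => ?_) ?_ ?_
  · have : Continuous sechSq := continuous_iff_continuousAt.2 fun x =>
      (hasDerivAt_sechSq x).continuousAt
    fun_prop
  · exact ((summable_exp_neg_mul_abs_int (by norm_num)).mul_left _).mul_left _
  · intro n k hk
    have hk1 : (1:ℝ) ≤ k := hk
    rw [Real.norm_of_nonneg (sechSq_pos _).le]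
    refine (sechSq_le_exp _).trans (mul_le_mul_of_nonneg_left ?_ (by norm_num))
    refine le_trans ?_ (exp_lattice_le one_pos le_rfl n)
    apply exp_le_exp.2
    rw [abs_mul, abs_mul, abs_of_pos (by linarith : (0:ℝ) < k), abs_one]
    nlinarith [abs_nonneg (x - n)]

theorem pow_four_le_sinh_sq {t : ℝ} (ht : 0 ≤ t) : t ^ 4 ≤ 16 * sinh t ^ 2 := by
  have h1 := quadratic_le_exp_of_nonneg ht
  have h2 : exp (-t) ≤ 1 := exp_le_one_iff.2 (by linarith)
  have h3 : t ^ 2 ≤ 4 * sinh t := by rw [sinh_eq]; linarith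
  nlinarith [sq_nonneg t]

theorem cosh_le_two_mul_sinh {t : ℝ} (ht : 1 ≤ t) : cosh t ≤ 2 * sinh t := by
  have h1 : t ≤ sinh t := self_le_sinh_iff.2 (by linarith)
  have h2 : exp (-t) ≤ 1 := exp_le_one_iff.2 (by linarith)
  have h3 := cosh_sub_sinh t
  linarith

/-- The interaction function of two solitary waves at distance `t`. -/
noncomputable def crestInteraction (t : ℝ) : ℝ :=
  t ^ 4 * (cosh t / sinh t ^ 3) - t ^ 3 * (sinh t ^ 2)⁻¹

theorem abs_crestInteraction_le {t : ℝ} (ht : 1 ≤ t) : |crestInteraction t| ≤ 48 := by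
  have hs : 0 < sinh t := sinh_pos_iff.2 (by linarith)
  have hc := cosh_le_two_mul_sinh ht
  have hc0 := cosh_pos t
  have h4 := pow_four_le_sinh_sq (by linarith : 0 ≤ t)
  have ht4 : t ^ 3 ≤ t ^ 4 := pow_le_pow_right₀ ht (by norm_num)
  have hT : t ^ 4 * (sinh t ^ 2)⁻¹ ≤ 16 := by
    rw [← div_eq_mul_inv, div_le_iff₀ (by positivity)]; exact h4
  have e1 : t ^ 4 * (cosh t / sinh t ^ 3) = (cosh t / sinh t) * (t ^ 4 * (sinh t ^ 2)⁻¹) := by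
    field_simp
  have e2 : t ^ 3 * (sinh t ^ 2)⁻¹ ≤ t ^ 4 * (sinh t ^ 2)⁻¹ := by gcongr
  have e3 : cosh t / sinh t ≤ 2 := by rw [div_le_iff₀ hs]; exact hc
  have e4 : 0 < cosh t / sinh t := by positivity
  have e5 : 0 ≤ t ^ 4 * (sinh t ^ 2)⁻¹ := by positivity
  have e6 : 0 ≤ t ^ 3 * (sinh t ^ 2)⁻¹ := by positivity
  rw [crestInteraction, e1, abs_le]
  constructor <;> nlinarith [mul_nonneg e4.le e5]

theorem hasDerivAt_crestInteraction {t : ℝ} (ht : 1 ≤ t) :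
    HasDerivAt crestInteraction (6 * t ^ 3 * (cosh t / sinh t ^ 3) + t ^ 4 * (sinh t ^ 2)⁻¹
      - 3 * t ^ 4 * (cosh t ^ 2 / sinh t ^ 4) - 3 * t ^ 2 * (sinh t ^ 2)⁻¹) t := by
  have hs : sinh t ≠ 0 := (sinh_pos_iff.2 (by linarith)).ne'
  have h1 := ((hasDerivAt_pow 4 t).mul ((hasDerivAt_cosh t).div ((hasDerivAt_sinh t).pow 3)
    (pow_ne_zero 3 hs))).sub ((hasDerivAt_pow 3 t).mul (((hasDerivAt_sinh t).pow 2).inv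
    (pow_ne_zero 2 hs)))
  refine h1.congr_deriv ?_
  simp only [Pi.pow_apply, Pi.div_apply, Pi.inv_apply]
  field_simp
  push_cast
  ring

theorem abs_deriv_crestInteraction_le {t : ℝ} (ht : 1 ≤ t) :
    |6 * t ^ 3 * (cosh t / sinh t ^ 3) + t ^ 4 * (sinh t ^ 2)⁻¹
      - 3 * t ^ 4 * (cosh t ^ 2 / sinh t ^ 4) - 3 * t ^ 2 * (sinh t ^ 2)⁻¹| ≤ 448 := by
  have hs : 0 < sinh t := sinh_pos_iff.2 (by linarith)
  have hc := cosh_le_two_mul_sinh ht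
  have hc0 := cosh_pos t
  have h4 := pow_four_le_sinh_sq (by linarith : 0 ≤ t)
  have ht3 : t ^ 3 ≤ t ^ 4 := pow_le_pow_right₀ ht (by norm_num)
  have ht2 : t ^ 2 ≤ t ^ 4 := pow_le_pow_right₀ ht (by norm_num)
  set P := (sinh t ^ 2)⁻¹ with hP
  have hP0 : 0 < P := by positivity
  set c := cosh t / sinh t with hc'
  have e3 : c ≤ 2 := by rw [hc', div_le_iff₀ hs]; exact hc
  have e4 : 0 < c := by positivity
  have e1 : cosh t / sinh t ^ 3 = c * P := by rw [hc', hP]; field_simp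
  have e2 : cosh t ^ 2 / sinh t ^ 4 = c ^ 2 * P := by rw [hc', hP]; field_simp
  have hT : t ^ 4 * P ≤ 16 := by
    rw [hP, ← div_eq_mul_inv, div_le_iff₀ (by positivity)]; exact h4
  have hT3 : t ^ 3 * P ≤ t ^ 4 * P := by gcongr
  have hT2 : t ^ 2 * P ≤ t ^ 4 * P := by gcongr
  have p3 : 0 ≤ t ^ 3 * P := by positivity
  have p2 : 0 ≤ t ^ 2 * P := by positivity
  have q1 : c * (t ^ 3 * P) ≤ 2 * 16 := by
    apply mul_le_mul e3 (by linarith) p3 (by norm_num)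
  have q2 : c ^ 2 * (t ^ 4 * P) ≤ 2 ^ 2 * 16 := by
    apply mul_le_mul (by gcongr) hT (by positivity) (by norm_num)
  have q1' : 0 ≤ c * (t ^ 3 * P) := by positivity
  have q2' : 0 ≤ c ^ 2 * (t ^ 4 * P) := by positivity
  rw [e1, e2, abs_le]
  constructor <;> linarith

theorem crestInteraction_lipschitz {s t : ℝ} (hs : 1 ≤ s) (hst : s ≤ t) :
    |crestInteraction t - crestInteraction s| ≤ 448 * (t - s) := by
  have := Convex.norm_image_sub_le_of_norm_hasDerivWithin_le (f := crestInteraction)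
    (C := 448) (s := Ici 1) (x := s) (y := t)
    (fun x hx => (hasDerivAt_crestInteraction hx).hasDerivWithinAt)
    (fun x hx => abs_deriv_crestInteraction_le hx) (convex_Ici 1) hs (hs.trans hst)
  rwa [Real.norm_eq_abs, Real.norm_eq_abs, abs_of_nonneg (sub_nonneg.2 hst)] at this

/-- The correction to the enstrophy due to the interaction of the crests. -/
noncomputable def interactionSum (k : ℝ) : ℝ :=
  ∑' j : ℕ, (((j : ℝ) + 1) ^ 3)⁻¹ * crestInteraction (k * (j + 1))

theorem interactionSum_eq {k : ℝ} (hk : 0 < k) :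
    interactionSum k = k ^ 4 * cothSum k - k ^ 3 * cschSum k := by
  rw [cothSum, cschSum, ← tsum_mul_left, ← tsum_mul_left,
    ← ((summable_cothSum hk).mul_left _).tsum_sub ((summable_cschSum hk).mul_left _)]
  refine tsum_congr fun j => ?_
  rw [crestInteraction]
  have : ((j:ℝ) + 1) ≠ 0 := by positivity
  field_simp

theorem summable_interactionSum {k : ℝ} (hk : 0 < k) :
    Summable fun j : ℕ => (((j : ℝ) + 1) ^ 3)⁻¹ * crestInteraction (k * (j + 1)) := by
  refine (((summable_cothSum hk).mul_left (k ^ 4)).sub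
    ((summable_cschSum hk).mul_left (k ^ 3))).congr fun j => ?_
  rw [crestInteraction]
  have : ((j:ℝ) + 1) ≠ 0 := by positivity
  field_simp

theorem inv_succ_cube_le (j : ℕ) : (((j:ℝ) + 1) ^ 3)⁻¹ ≤ (((j:ℝ) + 1) ^ 2)⁻¹ := by
  have : (1:ℝ) ≤ j + 1 := by linarith [Nat.cast_nonneg (α := ℝ) j]
  gcongr
  norm_num

theorem one_le_mul_succ {k : ℝ} (hk : 1 ≤ k) (j : ℕ) : 1 ≤ k * ((j:ℝ) + 1) := by
  have : (1:ℝ) ≤ j + 1 := by linarith [Nat.cast_nonneg (α := ℝ) j]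
  nlinarith

theorem abs_interactionSum_le {k : ℝ} (hk : 1 ≤ k) : |interactionSum k| ≤ 96 := by
  have h := tsum_of_norm_bounded (f := fun j : ℕ =>
    (((j : ℝ) + 1) ^ 3)⁻¹ * crestInteraction (k * (j + 1)))
    (hasSum_inv_succ_sq.summable.hasSum.mul_left 48) fun j => by
    rw [norm_mul, Real.norm_of_nonneg (by positivity), mul_comm]
    exact mul_le_mul (abs_crestInteraction_le (one_le_mul_succ hk j)) (inv_succ_cube_le j)
      (by positivity) (by norm_num)
  rw [Real.norm_eq_abs] at h
  have h2 := tsum_inv_succ_sq_le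
  refine h.trans (by linarith)

theorem interactionSum_lipschitz {s t : ℝ} (hs : 1 ≤ s) (hst : s ≤ t) :
    |interactionSum t - interactionSum s| ≤ 896 * (t - s) := by
  rw [interactionSum, interactionSum, ← (summable_interactionSum (by linarith)).tsum_sub
    (summable_interactionSum (by linarith))]
  have h := tsum_of_norm_bounded (f := fun j : ℕ =>
    (((j : ℝ) + 1) ^ 3)⁻¹ * crestInteraction (t * (j + 1)) -
    (((j : ℝ) + 1) ^ 3)⁻¹ * crestInteraction (s * (j + 1)))
    (hasSum_inv_succ_sq.summable.hasSum.mul_left (448 * (t - s))) fun j => by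
    rw [← mul_sub, norm_mul, Real.norm_of_nonneg (by positivity)]
    have h1 := crestInteraction_lipschitz (one_le_mul_succ hs j)
      (mul_le_mul_of_nonneg_right hst (by positivity : (0:ℝ) ≤ j + 1))
    have h0 : (0:ℝ) < j + 1 := by positivity
    calc (((j : ℝ) + 1) ^ 3)⁻¹ * ‖_‖ ≤ (((j : ℝ) + 1) ^ 3)⁻¹ *
        (448 * (t * (j + 1) - s * (j + 1))) := by gcongr; exact h1
      _ = 448 * (t - s) * (((j:ℝ) + 1) ^ 2)⁻¹ := by field_simp
  rw [Real.norm_eq_abs] at h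
  have h2 := tsum_inv_succ_sq_le
  refine h.trans ?_
  nlinarith

/-- Twice the enstrophy of the normalised cnoidal wave. -/
noncomputable def crestNormSq (k : ℝ) : ℝ :=
  64 / 3 * k ^ 3 - 64 * k ^ 2 + 128 * interactionSum k

theorem crestNormSq_lt {s t : ℝ} (hs : 100 ≤ s) (hst : s < t) : crestNormSq s < crestNormSq t := by
  have h := (abs_le.1 (interactionSum_lipschitz (by linarith) hst.le)).1
  have h2 : 114688 * (t - s) < 64 / 3 * (t ^ 3 - s ^ 3) - 64 * (t ^ 2 - s ^ 2) := by
    have : 64 / 3 * (t ^ 3 - s ^ 3) - 64 * (t ^ 2 - s ^ 2) - 114688 * (t - s) =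
      (t - s) * (64 / 3 * (t ^ 2 + t * s + s ^ 2) - 64 * (t + s) - 114688) := by ring
    have h3 : 0 < (t - s) * (64 / 3 * (t ^ 2 + t * s + s ^ 2) - 64 * (t + s) - 114688) := by
      apply mul_pos (by linarith)
      nlinarith
    linarith
  rw [crestNormSq, crestNormSq]
  linarith

theorem continuousOn_crestNormSq : ContinuousOn crestNormSq (Ici 1) := by
  have : ContinuousOn interactionSum (Ici 1) := by
    refine (LipschitzOnWith.of_dist_le_mul (K := 896) fun s hs t ht => ?_).continuousOn
    rw [Real.dist_eq, Real.dist_eq]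
    rcases le_total s t with h | h
    · rw [abs_sub_comm, abs_sub_comm s, abs_of_nonneg (sub_nonneg.2 h)]
      exact interactionSum_lipschitz hs h
    · rw [abs_of_nonneg (sub_nonneg.2 h)]
      exact interactionSum_lipschitz ht h
  unfold crestNormSq
  fun_prop

/-- The zero-mean cnoidal wave with a crest at the origin. -/
noncomputable def crestWave (k x : ℝ) : ℝ := 4 * k ^ 2 * sechSum k x + -(8 * k)

theorem isCnoidal_crestWave {k : ℝ} (hk : 0 < k) :
    IsCnoidal (4 * k ^ 2 - 24 * k - 24 * k ^ 2 * cschSum k)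
      (192 * k ^ 4 * cothSum k + 32 * k ^ 3 - 192 * k ^ 3 * cschSum k - 96 * k ^ 2)
      (crestWave k) (fun x => 4 * k ^ 2 * sechSum' k x) := by
  have := (isCnoidal_sechSum hk).add_const (-(8 * k))
  have e1 : 4 * k ^ 2 - 24 * k - 24 * k ^ 2 * cschSum k =
      4 * k ^ 2 - 24 * k ^ 2 * cschSum k + 3 * -(8 * k) := by ring
  have e2 : 192 * k ^ 4 * cothSum k + 32 * k ^ 3 - 192 * k ^ 3 * cschSum k - 96 * k ^ 2 =
      192 * k ^ 4 * cothSum k - (4 * k ^ 2 - 24 * k ^ 2 * cschSum k) * -(8 * k) -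
        3 / 2 * (-(8 * k)) ^ 2 := by ring
  rw [e1, e2]
  exact this

theorem integral_crestWave {k : ℝ} (hk : 0 < k) : ∫ x in (0:ℝ)..1, crestWave k x = 0 := by
  simp only [crestWave]
  rw [intervalIntegral.integral_add (((continuous_sechSum hk).const_mul _).intervalIntegrable _ _)
    (by simp), intervalIntegral.integral_const_mul, integral_sechSum hk,
    intervalIntegral.integral_const]
  simp
  field_simp
  ring

/-- Averaging the profile equation over a period. -/
theorem IsCnoidal.integral_sq {lam mu : ℝ} {w w' : ℝ → ℝ} (h : IsCnoidal lam mu w w')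
    (h0 : ∫ x in (0:ℝ)..1, w x = 0) : ∫ x in (0:ℝ)..1, w x ^ 2 = 2 / 3 * mu := by
  have hc := h.continuous
  have h1 := integral_eq_sub_of_hasDerivAt (a := 0) (b := 1) (fun x _ => h.hasDeriv₂ x)
    ((by fun_prop : Continuous fun x => -(3/2) * w x ^ 2 + lam * w x + mu).intervalIntegrable _ _)
  have hp := h.periodic_deriv 0
  rw [zero_add] at hp
  rw [hp, sub_self, intervalIntegral.integral_add
    ((by fun_prop : Continuous fun x => -(3/2) * w x ^ 2 + lam * w x).intervalIntegrable _ _)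
    (by simp), intervalIntegral.integral_add
    ((by fun_prop : Continuous fun x => -(3/2) * w x ^ 2).intervalIntegrable _ _)
    ((by fun_prop : Continuous fun x => lam * w x).intervalIntegrable _ _),
    intervalIntegral.integral_const_mul, intervalIntegral.integral_const_mul, h0,
    intervalIntegral.integral_const] at h1
  simp only [sub_zero, smul_eq_mul, one_mul] at h1
  linarith

theorem integral_crestWave_sq {k : ℝ} (hk : 0 < k) :
    ∫ x in (0:ℝ)..1, crestWave k x ^ 2 = crestNormSq k := by
  rw [(isCnoidal_crestWave hk).integral_sq (integral_crestWave hk), crestNormSq,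
    interactionSum_eq hk]
  ring

theorem sechSum_zero_ge {k : ℝ} (hk : 1 ≤ k) : 1 ≤ sechSum k 0 := by
  have := (sechSum_sub_mem hk (x := 0) (by norm_num)).1
  rw [mul_zero, sechSq_zero] at this
  linarith

theorem sechSum_le_half {k x : ℝ} (hk : 100 ≤ k) (hx : 1 / 4 ≤ x) (hx2 : x ≤ 1 / 2) :
    sechSum k x ≤ 1 / 2 := by
  have h1 := (sechSum_sub_mem (k := k) (by linarith) (x := x) (by rw [abs_of_pos] <;> linarith)).2
  have h2 := sechSq_le_exp (k * x)
  have h3 : exp (-2 * |k * x|) ≤ exp (-50) := by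
    apply exp_le_exp.2
    rw [abs_of_pos (by nlinarith)]
    nlinarith
  have h4 : exp (-k) ≤ exp (-50) := exp_le_exp.2 (by linarith)
  have h5 : exp (-50) ≤ 1 / 51 := by
    rw [exp_neg, ← one_div]
    exact one_div_le_one_div_of_le (by norm_num) (by linarith [add_one_le_exp (50:ℝ)])
  linarith

/-- The amplitude of the cnoidal wave. -/
noncomputable def crestAmplitude (k : ℝ) : ℝ := 4 * k ^ 2 * (sechSum k 0 - sechSum k (1 / 2))

theorem crestAmplitude_ge {k : ℝ} (hk : 100 ≤ k) : 2 * k ^ 2 ≤ crestAmplitude k := by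
  have h1 := sechSum_zero_ge (k := k) (by linarith)
  have h2 := sechSum_le_half hk (x := 1 / 2) (by norm_num) le_rfl
  rw [crestAmplitude]
  nlinarith [sq_nonneg k]

theorem exists_crestAmplitude_eq {a : ℝ} (ha : crestAmplitude 100 ≤ a) :
    ∃ k, 100 ≤ k ∧ crestAmplitude k = a := by
  have hc : ContinuousOn crestAmplitude (Ici 1) := by
    have h0 := continuousOn_sechSum_left 0
    have h1 := continuousOn_sechSum_left (1 / 2)
    unfold crestAmplitude
    fun_prop
  have hm : 100 ≤ max 100 a := le_max_left _ _
  have := intermediate_value_Icc hm (hc.mono (fun x hx => (by norm_num : (1:ℝ) ≤ 100).trans hx.1))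
  obtain ⟨k, hk, hk2⟩ := this ⟨ha, by
    have h1 := crestAmplitude_ge hm
    nlinarith [le_max_right 100 a]⟩
  exact ⟨k, hk.1, hk2⟩

theorem exists_crestNormSq_eq {a : ℝ} (ha : crestNormSq 100 ≤ a) :
    ∃ k, 100 ≤ k ∧ crestNormSq k = a := by
  have hm : 100 ≤ max 100 a := le_max_left _ _
  have := intermediate_value_Icc hm
    (continuousOn_crestNormSq.mono (fun x hx => (by norm_num : (1:ℝ) ≤ 100).trans hx.1))
  obtain ⟨k, hk, hk2⟩ := this ⟨ha, by
    have h1 := (abs_le.1 (abs_interactionSum_le (k := max 100 a) (by linarith))).1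
    rw [crestNormSq]
    nlinarith [le_max_right 100 a]⟩
  exact ⟨k, hk.1, hk2⟩

theorem IsCnoidal.deriv_zero_of_even {lam mu : ℝ} {w w' : ℝ → ℝ} (h : IsCnoidal lam mu w w')
    (he : ∀ x, w (-x) = w x) : w' 0 = 0 := by
  have h1 := h.reflect.hasDeriv 0
  have h2 : (fun x => w (-x)) = w := funext he
  rw [h2] at h1
  have := h1.unique (h.hasDeriv 0)
  rw [neg_zero] at this
  linarith

theorem exists_nat_mul_mem {p : ℝ} (hp : 0 < p) (hp2 : p ≤ 1 / 2) :
    ∃ n : ℕ, 1 / 4 ≤ n * p ∧ n * p ≤ 1 / 2 := by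
  rcases le_total (1 / 4) p with h | h
  · exact ⟨1, by simpa using h, by simpa using hp2⟩
  · refine ⟨⌈1 / (4 * p)⌉₊, ?_, ?_⟩
    · have := Nat.le_ceil (1 / (4 * p))
      calc 1 / 4 = 1 / (4 * p) * p := by field_simp
        _ ≤ _ := by gcongr
    · have := (Nat.ceil_lt_add_one (by positivity : 0 ≤ 1 / (4 * p))).le
      calc _ ≤ (1 / (4 * p) + 1) * p := by gcongr
        _ = 1 / 4 + p := by field_simp
        _ ≤ 1 / 2 := by linarith

theorem IsCnoidal.eq_max_or_eq_min {w w' : ℝ → ℝ} {M m r : ℝ} (hrm : r < m)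
    (hm : ∀ x, m ≤ w x) (hfac : ∀ x, w' x ^ 2 = (M - w x) * (w x - m) * (w x - r)) {a : ℝ}
    (ha : w' a = 0) : w a = M ∨ w a = m := by
  have h1 := hfac a
  rw [ha] at h1
  have h2 : 0 < w a - r := by linarith [hm a]
  have h3 : (M - w a) * (w a - m) = 0 := by
    have : (M - w a) * (w a - m) * (w a - r) = 0 := by rw [← h1]; norm_num
    exact (mul_eq_zero.1 this).resolve_right h2.ne'
  rcases mul_eq_zero.1 h3 with h | h
  · left; linarith
  · right; linarith

theorem isSingleCrest_crestWave {k : ℝ} (hk : 100 ≤ k) :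
    ∃ M m r, IsSingleCrest M m r (crestWave k) (fun x => 4 * k ^ 2 * sechSum' k x) ∧
      4 * k ^ 2 - 24 * k - 24 * k ^ 2 * cschSum k = M + m + r ∧ M - m = crestAmplitude k := by
  have hk0 : 0 < k := by linarith
  have h := isCnoidal_crestWave hk0
  have hlt : ∀ x, 1 / 4 ≤ x → x ≤ 1 / 2 → crestWave k x < crestWave k 0 := by
    intro x h1 h2
    have h3 := sechSum_zero_ge (k := k) (by linarith)
    have h4 := sechSum_le_half hk h1 h2
    rw [crestWave, crestWave]
    nlinarith [pow_pos hk0 2]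
  have hhalf := hlt (1 / 2) (by norm_num) le_rfl
  obtain ⟨M, m, r, hrm, hmM, -, -, hM, hm, hlam, hfac⟩ := h.exists_roots ⟨_, _, hhalf.ne⟩
  have he : ∀ x, crestWave k (-x) = crestWave k x := fun x => by
    rw [crestWave, sechSum_neg, crestWave]
  have h0 : crestWave k 0 = M :=
    (IsCnoidal.eq_max_or_eq_min hrm hm hfac (h.deriv_zero_of_even he)).resolve_right fun h1 => by
      linarith [hm (1 / 2)]
  rcases h.short_period_or_monotone hrm hmM h0 hM hm hfac with ⟨p, hp, hp2, hper⟩ | ⟨hanti, htr⟩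
  · obtain ⟨n, hn1, hn2⟩ := exists_nat_mul_mem hp hp2
    have := hper.nat_mul n 0
    rw [zero_add] at this
    exact absurd this (hlt _ hn1 hn2).ne
  · refine ⟨M, m, r, ⟨hrm, hmM, h0, htr, hM, hm, hanti, hfac⟩, hlam, ?_⟩
    rw [← h0, ← htr, crestWave, crestWave, crestAmplitude]
    ring

/-- Lebesgue measure on the unit interval. -/
noncomputable abbrev unitMeasure : Measure ℝ := volume.restrict (Ioc (0:ℝ) 1)

/-- Square integrable functions on the unit interval. -/
noncomputable abbrev UnitL2 : Type := Lp ℝ 2 unitMeasure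

namespace UnitL2

theorem integrable (f : UnitL2) : Integrable f unitMeasure :=
  (Lp.memLp f).integrable one_le_two

/-- The primitive vanishing at the origin. -/
noncomputable def prim (f : UnitL2) (x : ℝ) : ℝ := ∫ t in (0:ℝ)..x, f t ∂unitMeasure

theorem intervalIntegrable (f : UnitL2) (a b : ℝ) : IntervalIntegrable f unitMeasure a b :=
  ⟨f.integrable.integrableOn, f.integrable.integrableOn⟩

theorem continuous_prim (f : UnitL2) : Continuous f.prim :=
  intervalIntegral.continuous_primitive f.intervalIntegrable 0

theorem prim_zero_right (f : UnitL2) : f.prim 0 = 0 := intervalIntegral.integral_same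

theorem prim_add (f g : UnitL2) (x : ℝ) : (f + g).prim x = f.prim x + g.prim x := by
  rw [prim, prim, prim, ← intervalIntegral.integral_add (f.intervalIntegrable _ _)
    (g.intervalIntegrable _ _)]
  exact intervalIntegral.integral_congr_ae ((Lp.coeFn_add f g).mono fun x hx _ => hx)

theorem prim_smul (c : ℝ) (f : UnitL2) (x : ℝ) : (c • f).prim x = c * f.prim x := by
  rw [prim, prim, ← intervalIntegral.integral_const_mul]
  exact intervalIntegral.integral_congr_ae ((Lp.coeFn_smul c f).mono fun x hx _ => hx)

theorem prim_eq_inner (f : UnitL2) {x : ℝ} (hx : 0 ≤ x) :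
    f.prim x = inner ℝ (indicatorConstLp 2 measurableSet_Ioc (measure_ne_top _ (Ioc 0 x)) 1) f := by
  rw [L2.inner_indicatorConstLp_one, prim, intervalIntegral.integral_of_le hx]

theorem abs_prim_le (f : UnitL2) {x : ℝ} (hx : 0 ≤ x) : |f.prim x| ≤ ‖f‖ := by
  rw [prim_eq_inner f hx]
  refine (abs_real_inner_le_norm _ _).trans (mul_le_of_le_one_left (norm_nonneg _) ?_)
  rw [norm_indicatorConstLp (by norm_num) (by norm_num), norm_one, one_mul]
  refine rpow_le_one measureReal_nonneg ?_ (by norm_num)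
  have : unitMeasure.real (Ioc 0 x) ≤ unitMeasure.real univ := measureReal_mono (subset_univ _)
  refine this.trans ?_
  simp [Measure.real]

/-- The mean of the primitive of the mean-free part. -/
noncomputable def offset (f : UnitL2) : ℝ := ∫ s in (0:ℝ)..1, (f.prim s - s * f.prim 1)

/-- The mean-free primitive of the mean-free part. -/
noncomputable def antideriv (f : UnitL2) (x : ℝ) : ℝ := f.prim x - x * f.prim 1 - f.offset

theorem continuous_antideriv (f : UnitL2) : Continuous f.antideriv := by
  have := f.continuous_prim
  unfold antideriv
  fun_prop

theorem offset_add (f g : UnitL2) : (f + g).offset = f.offset + g.offset := by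
  have h1 := f.continuous_prim
  have h2 := g.continuous_prim
  rw [offset, offset, offset, ← intervalIntegral.integral_add
    ((by fun_prop : Continuous fun s => f.prim s - s * f.prim 1).intervalIntegrable _ _)
    ((by fun_prop : Continuous fun s => g.prim s - s * g.prim 1).intervalIntegrable _ _)]
  refine intervalIntegral.integral_congr fun s _ => ?_
  simp only [prim_add]
  ring

theorem offset_smul (c : ℝ) (f : UnitL2) : (c • f).offset = c * f.offset := by
  rw [offset, offset, ← intervalIntegral.integral_const_mul]
  refine intervalIntegral.integral_congr fun s _ => ?_
  simp only [prim_smul]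
  ring

theorem antideriv_add (f g : UnitL2) (x : ℝ) :
    (f + g).antideriv x = f.antideriv x + g.antideriv x := by
  simp only [antideriv, prim_add, offset_add]; ring

theorem antideriv_smul (c : ℝ) (f : UnitL2) (x : ℝ) :
    (c • f).antideriv x = c * f.antideriv x := by
  simp only [antideriv, prim_smul, offset_smul]; ring

theorem integral_antideriv (f : UnitL2) : ∫ x in (0:ℝ)..1, f.antideriv x = 0 := by
  have h1 := f.continuous_prim
  simp only [antideriv]
  rw [intervalIntegral.integral_sub
    ((by fun_prop : Continuous fun s => f.prim s - s * f.prim 1).intervalIntegrable _ _)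
    (by simp), intervalIntegral.integral_const, ← offset]
  simp

theorem antideriv_zero_eq_one (f : UnitL2) : f.antideriv 0 = f.antideriv 1 := by
  simp only [antideriv, prim_zero_right]; ring

theorem abs_offset_le (f : UnitL2) : |f.offset| ≤ 2 * ‖f‖ := by
  have := intervalIntegral.norm_integral_le_of_norm_le_const (a := 0) (b := 1)
    (f := fun s => f.prim s - s * f.prim 1) (C := 2 * ‖f‖) fun s hs => by
    rw [uIoc_of_le zero_le_one] at hs
    have h1 := f.abs_prim_le hs.1.le
    have h2 := f.abs_prim_le zero_le_one
    rw [Real.norm_eq_abs]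
    refine (abs_sub _ _).trans ?_
    rw [abs_mul, abs_of_pos hs.1]
    nlinarith [hs.2, abs_nonneg (f.prim 1)]
  simpa [offset] using this

theorem abs_antideriv_le (f : UnitL2) {x : ℝ} (hx : x ∈ Icc (0:ℝ) 1) :
    |f.antideriv x| ≤ 4 * ‖f‖ := by
  have h1 := f.abs_prim_le hx.1
  have h2 := f.abs_prim_le zero_le_one
  have h3 := f.abs_offset_le
  rw [antideriv]
  refine (abs_sub _ _).trans ?_
  have := abs_sub (f.prim x) (x * f.prim 1)
  rw [abs_mul, abs_of_nonneg hx.1] at this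
  nlinarith [hx.2, abs_nonneg (f.prim 1)]

theorem memLp_of_continuous {q : ℝ → ℝ} (hq : Continuous q) : MemLp q 2 unitMeasure := by
  obtain ⟨C, hC⟩ := isCompact_Icc.exists_bound_of_continuousOn (s := Icc (0:ℝ) 1) hq.continuousOn
  refine MemLp.of_bound hq.aestronglyMeasurable C ?_
  filter_upwards [ae_restrict_mem measurableSet_Ioc] with x hx
  exact hC x ⟨hx.1.le, hx.2⟩

/-- The element of `UnitL2` defined by a continuous function. -/
noncomputable def ofContinuous {q : ℝ → ℝ} (hq : Continuous q) : UnitL2 :=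
  (memLp_of_continuous hq).toLp q

theorem coeFn_ofContinuous {q : ℝ → ℝ} (hq : Continuous q) :
    ofContinuous hq =ᵐ[unitMeasure] q := MemLp.coeFn_toLp _

theorem inner_ofContinuous {p q : ℝ → ℝ} (hp : Continuous p) (hq : Continuous q) :
    inner ℝ (ofContinuous hp) (ofContinuous hq) = ∫ x in (0:ℝ)..1, p x * q x := by
  rw [L2.inner_def, intervalIntegral.integral_of_le zero_le_one]
  refine integral_congr_ae ?_
  filter_upwards [coeFn_ofContinuous hp, coeFn_ofContinuous hq] with x h1 h2
  rw [h1, h2]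
  simp [mul_comm]

theorem prim_ofContinuous {q : ℝ → ℝ} (hq : Continuous q) {x : ℝ} (hx : x ∈ Icc (0:ℝ) 1) :
    (ofContinuous hq).prim x = ∫ t in (0:ℝ)..x, q t := by
  rw [prim, intervalIntegral.integral_congr_ae ((coeFn_ofContinuous hq).mono fun x hx _ => hx),
    intervalIntegral.integral_of_le hx.1, intervalIntegral.integral_of_le hx.1,
    Measure.restrict_restrict measurableSet_Ioc]
  congr 2
  exact inter_eq_left.2 (Ioc_subset_Ioc_right hx.2)

/-- A mean-free periodic function is recovered from its derivative. -/
theorem antideriv_ofContinuous {v v' : ℝ → ℝ} (hv : ∀ x, HasDerivAt v (v' x) x)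
    (hv' : Continuous v') (h01 : v 1 = v 0) (h0 : ∫ x in (0:ℝ)..1, v x = 0) {x : ℝ}
    (hx : x ∈ Icc (0:ℝ) 1) : (ofContinuous hv').antideriv x = v x := by
  have hp : ∀ x ∈ Icc (0:ℝ) 1, (ofContinuous hv').prim x = v x - v 0 := fun x hx => by
    rw [prim_ofContinuous hv' hx]
    exact integral_eq_sub_of_hasDerivAt (fun x _ => hv x) (hv'.intervalIntegrable _ _)
  have h1 := hp 1 (right_mem_Icc.2 zero_le_one)
  rw [h01, sub_self] at h1
  have hvc : Continuous v := continuous_iff_continuousAt.2 fun x => (hv x).continuousAt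
  have hoff : (ofContinuous hv').offset = -v 0 := by
    rw [offset, intervalIntegral.integral_congr (g := fun s => v s - v 0) fun s hs => by
      rw [uIcc_of_le zero_le_one] at hs
      simp only [hp s hs, h1]; ring]
    rw [intervalIntegral.integral_sub (hvc.intervalIntegrable _ _) (by simp), h0]
    simp
  rw [antideriv, hp x hx, h1, hoff]
  ring

end UnitL2

namespace UnitL2

/-- A bounded sequence in `UnitL2` has a weakly convergent subsequence. -/
theorem exists_weak_limit {F : ℕ → UnitL2} {R : ℝ} (hF : ∀ n, ‖F n‖ ≤ R) :
    ∃ (f : UnitL2) (φ : ℕ → ℕ), StrictMono φ ∧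
      ∀ h : UnitL2, Filter.Tendsto (fun n => inner ℝ (F (φ n)) h) Filter.atTop
        (nhds (inner ℝ f h)) := by
  have : Fact ((2 : ENNReal) ≠ ⊤) := ⟨by norm_num⟩
  have hcpt := WeakDual.isSeqCompact_closedBall ℝ UnitL2 0 R
  obtain ⟨a, -, φ, hφ, hlim⟩ := hcpt (x := fun n =>
    WeakDual.toStrongDual.symm (InnerProductSpace.toDual ℝ UnitL2 (F n))) fun n => by
      simpa using hF n
  refine ⟨(InnerProductSpace.toDual ℝ UnitL2).symm (WeakDual.toStrongDual a), φ, hφ, fun h => ?_⟩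
  have h1 := ((WeakDual.eval_continuous h).tendsto a).comp hlim
  rw [InnerProductSpace.toDual_symm_apply]
  exact h1

theorem tendsto_antideriv {F : ℕ → UnitL2} {f : UnitL2} {R : ℝ} (hF : ∀ n, ‖F n‖ ≤ R)
    (hw : ∀ h : UnitL2, Filter.Tendsto (fun n => inner ℝ (F n) h) Filter.atTop
      (nhds (inner ℝ f h))) {x : ℝ} (hx : x ∈ Icc (0:ℝ) 1) :
    Filter.Tendsto (fun n => (F n).antideriv x) Filter.atTop (nhds (f.antideriv x)) := by
  have hp : ∀ x, 0 ≤ x → Filter.Tendsto (fun n => (F n).prim x) Filter.atTop (nhds (f.prim x)) := by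
    intro x hx
    have := hw (indicatorConstLp 2 measurableSet_Ioc (measure_ne_top _ (Ioc 0 x)) 1)
    rw [real_inner_comm, ← prim_eq_inner f hx] at this
    refine this.congr fun n => ?_
    rw [real_inner_comm, ← prim_eq_inner _ hx]
  have hoff : Filter.Tendsto (fun n => (F n).offset) Filter.atTop (nhds f.offset) := by
    refine intervalIntegral.tendsto_integral_filter_of_dominated_convergence (fun _ => 2 * R)
      (Filter.Eventually.of_forall fun n => ?_) (Filter.Eventually.of_forall fun n => ?_)
      (by simp) (Filter.Eventually.of_forall fun s hs => ?_)
    · have := (F n).continuous_prim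
      exact (by fun_prop : Continuous fun s => (F n).prim s - s * (F n).prim 1).aestronglyMeasurable
    · refine Filter.Eventually.of_forall fun s hs => ?_
      rw [uIoc_of_le zero_le_one] at hs
      have h1 := (F n).abs_prim_le hs.1.le
      have h2 := (F n).abs_prim_le zero_le_one
      have h3 := hF n
      rw [Real.norm_eq_abs]
      refine (abs_sub _ _).trans ?_
      rw [abs_mul, abs_of_pos hs.1]
      nlinarith [hs.2, abs_nonneg ((F n).prim 1)]
    · rw [uIoc_of_le zero_le_one] at hs
      exact (hp s hs.1.le).sub ((hp 1 zero_le_one).const_mul s)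
  exact ((hp x hx.1).sub ((hp 1 zero_le_one).const_mul x)).sub hoff

/-- Twice the enstrophy. -/
noncomputable def normSq (f : UnitL2) : ℝ := ∫ x in (0:ℝ)..1, f.antideriv x ^ 2

/-- The cubic term of the enstrophy rate. -/
noncomputable def cubic (f : UnitL2) : ℝ := ∫ x in (0:ℝ)..1, f.antideriv x ^ 3

theorem tendsto_integral_antideriv_pow {F : ℕ → UnitL2} {f : UnitL2} {R : ℝ} (hF : ∀ n, ‖F n‖ ≤ R)
    (hw : ∀ h : UnitL2, Filter.Tendsto (fun n => inner ℝ (F n) h) Filter.atTop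
      (nhds (inner ℝ f h))) (p : ℕ) :
    Filter.Tendsto (fun n => ∫ x in (0:ℝ)..1, (F n).antideriv x ^ p) Filter.atTop
      (nhds (∫ x in (0:ℝ)..1, f.antideriv x ^ p)) := by
  refine intervalIntegral.tendsto_integral_filter_of_dominated_convergence (fun _ => (4 * R) ^ p)
      (Filter.Eventually.of_forall fun n => ?_) (Filter.Eventually.of_forall fun n => ?_)
      (by simp) (Filter.Eventually.of_forall fun s hs => ?_)
  · exact ((F n).continuous_antideriv.pow p).aestronglyMeasurable
  · refine Filter.Eventually.of_forall fun s hs => ?_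
    rw [uIoc_of_le zero_le_one] at hs
    rw [norm_pow, Real.norm_eq_abs]
    have := ((F n).abs_antideriv_le (Ioc_subset_Icc_self hs)).trans
      (mul_le_mul_of_nonneg_left (hF n) (by norm_num))
    gcongr
  · rw [uIoc_of_le zero_le_one] at hs
    exact (tendsto_antideriv hF hw (Ioc_subset_Icc_self hs)).pow p

theorem cubic_le (f : UnitL2) : f.cubic ≤ 4 * ‖f‖ * f.normSq := by
  have hc := f.continuous_antideriv
  rw [cubic, normSq, ← intervalIntegral.integral_const_mul]
  refine intervalIntegral.integral_mono_on zero_le_one ((hc.pow 3).intervalIntegrable _ _)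
    (((hc.pow 2).const_mul _).intervalIntegrable _ _) fun x hx => ?_
  have := (abs_le.1 (f.abs_antideriv_le hx)).2
  nlinarith [sq_nonneg (f.antideriv x)]

theorem normSq_smul (s : ℝ) (f : UnitL2) : (s • f).normSq = s ^ 2 * f.normSq := by
  rw [normSq, normSq, ← intervalIntegral.integral_const_mul]
  refine intervalIntegral.integral_congr fun x _ => ?_
  simp only [antideriv_smul]; ring

theorem cubic_smul (s : ℝ) (f : UnitL2) : (s • f).cubic = s ^ 3 * f.cubic := by
  rw [cubic, cubic, ← intervalIntegral.integral_const_mul]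
  refine intervalIntegral.integral_congr fun x _ => ?_
  simp only [antideriv_smul]; ring

theorem exists_normSq_eq {c : ℝ} (hc : 0 < c) : ∃ f : UnitL2, f.normSq = c := by
  have hk : (0:ℝ) < 100 := by norm_num
  have h := isCnoidal_crestWave hk
  have h1 : (ofContinuous h.continuous_deriv).normSq = crestNormSq 100 := by
    rw [← integral_crestWave_sq hk]
    refine intervalIntegral.integral_congr fun x hx => ?_
    rw [uIcc_of_le zero_le_one] at hx
    rw [antideriv_ofContinuous h.hasDeriv h.continuous_deriv (by simpa using h.periodic 0)
      (integral_crestWave hk) hx]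
  have h2 : 0 < crestNormSq 100 := by
    have := (abs_le.1 (abs_interactionSum_le (k := 100) (by norm_num))).1
    rw [crestNormSq]; linarith
  refine ⟨√(c / crestNormSq 100) • ofContinuous h.continuous_deriv, ?_⟩
  rw [normSq_smul, h1, sq_sqrt (by positivity)]
  field_simp

/-- The direct method for the constrained maximization problem. -/
theorem exists_maximizer {c : ℝ} (hc : 0 < c) : ∃ f : UnitL2, f.normSq = c ∧
    ∀ g : UnitL2, g.normSq = c → g.cubic - ‖g‖ ^ 2 ≤ f.cubic - ‖f‖ ^ 2 := by
  set S : Set ℝ := {a | ∃ g : UnitL2, g.normSq = c ∧ g.cubic - ‖g‖ ^ 2 = a} with hS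
  have hne : S.Nonempty := by
    obtain ⟨f, hf⟩ := exists_normSq_eq hc
    exact ⟨_, f, hf, rfl⟩
  have hbdd : BddAbove S := by
    refine ⟨4 * c ^ 2, ?_⟩
    rintro a ⟨g, hg, rfl⟩
    have := g.cubic_le
    rw [hg] at this
    nlinarith [sq_nonneg (‖g‖ - 2 * c)]
  obtain ⟨u, humono, hu, huS⟩ := exists_seq_tendsto_sSup hne hbdd
  choose F hFc hFu using huS
  have hFR : ∀ n, ‖F n‖ ≤ 4 * c + 1 + |u 0| := fun n => by
    have h1 := (F n).cubic_le
    rw [hFc n] at h1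
    have h2 := humono (Nat.zero_le n)
    rw [← hFu n] at h2
    have h3 := neg_abs_le (u 0)
    by_contra! hlt
    nlinarith [abs_nonneg (u 0), norm_nonneg (F n)]
  obtain ⟨f, φ, hφ, hw⟩ := exists_weak_limit hFR
  have hFR' : ∀ n, ‖F (φ n)‖ ≤ 4 * c + 1 + |u 0| := fun n => hFR _
  have hB := tendsto_integral_antideriv_pow hFR' hw 2
  have hA := tendsto_integral_antideriv_pow hFR' hw 3
  refine ⟨f, ?_, ?_⟩
  · exact tendsto_nhds_unique hB (tendsto_const_nhds.congr fun n => (hFc (φ n)).symm)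
  · have hle : sSup S ≤ f.cubic - ‖f‖ ^ 2 := by
      have h1 := hA.sub (((hw f).const_mul 2).sub (tendsto_const_nhds (x := ‖f‖ ^ 2)))
      have h2 : f.cubic - ‖f‖ ^ 2 = (∫ x in (0:ℝ)..1, f.antideriv x ^ 3) -
          (2 * inner ℝ f f - ‖f‖ ^ 2) := by
        rw [real_inner_self_eq_norm_sq, cubic]; ring
      rw [h2]
      refine le_of_tendsto_of_tendsto' (hu.comp hφ.tendsto_atTop) h1 fun n => ?_
      have h3 := hFu (φ n)
      have h4 := norm_sub_sq_real (F (φ n)) f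
      have h5 := sq_nonneg ‖F (φ n) - f‖
      rw [cubic] at h3
      simp only [Function.comp]
      linarith
    intro g hg
    exact (le_csSup hbdd ⟨g, hg, rfl⟩).trans hle

end UnitL2

/-- The first-order condition for `s³ A − s² D` under the normalization `s² N = N 0`. -/
theorem eq_of_isLocalMax_normalized {N A D : ℝ → ℝ} {N' A' D' : ℝ} (hN0 : 0 < N 0)
    (hN : HasDerivAt N N' 0) (hA : HasDerivAt A A' 0) (hD : HasDerivAt D D' 0)
    (hmax : ∀ t, 0 < N t →
      √(N 0 / N t) ^ 3 * A t - √(N 0 / N t) ^ 2 * D t ≤ A 0 - D 0) :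
    D' = A' - (3 * A 0 - 2 * D 0) / (2 * N 0) * N' := by
  have hs : HasDerivAt (fun t => √(N 0 / N t)) (-N' / (2 * N 0)) 0 := by
    have h1 : HasDerivAt (fun t => N 0 / N t) (-N' / N 0) 0 :=
      ((hasDerivAt_const (0:ℝ) (N 0)).div hN hN0.ne').congr_deriv (by field_simp; ring)
    refine (h1.sqrt (by simp [hN0.ne'])).congr_deriv ?_
    rw [div_self hN0.ne', sqrt_one]
    field_simp
  have hφ := ((hs.pow 3).mul hA).sub ((hs.pow 2).mul hD)
  have hloc : IsLocalMax (((fun t => √(N 0 / N t)) ^ 3) * A - ((fun t => √(N 0 / N t)) ^ 2) * D)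
      0 := by
    filter_upwards [hN.continuousAt.eventually (lt_mem_nhds hN0)] with t ht
    simpa [div_self hN0.ne'] using hmax t ht
  have h0 := hloc.hasDerivAt_eq_zero hφ
  simp only [Pi.pow_apply, div_self hN0.ne', sqrt_one] at h0
  norm_num at h0
  field_simp
  field_simp at h0
  linarith

namespace UnitL2

theorem normSq_add_smul (f h : UnitL2) (t : ℝ) : (f + t • h).normSq = f.normSq +
    t * (2 * ∫ x in (0:ℝ)..1, f.antideriv x * h.antideriv x) + t ^ 2 * h.normSq := by
  have hf := f.continuous_antideriv
  have hh := h.continuous_antideriv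
  simp only [normSq, ← intervalIntegral.integral_const_mul]
  rw [← intervalIntegral.integral_add, ← intervalIntegral.integral_add]
  · refine intervalIntegral.integral_congr fun x _ => ?_
    simp only [antideriv_add, antideriv_smul]
    ring
  all_goals exact Continuous.intervalIntegrable (by fun_prop) _ _

theorem cubic_add_smul (f h : UnitL2) (t : ℝ) : (f + t • h).cubic = f.cubic +
    t * (3 * ∫ x in (0:ℝ)..1, f.antideriv x ^ 2 * h.antideriv x) +
    t ^ 2 * (3 * ∫ x in (0:ℝ)..1, f.antideriv x * h.antideriv x ^ 2) + t ^ 3 * h.cubic := by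
  have hf := f.continuous_antideriv
  have hh := h.continuous_antideriv
  simp only [cubic, ← intervalIntegral.integral_const_mul]
  rw [← intervalIntegral.integral_add, ← intervalIntegral.integral_add,
    ← intervalIntegral.integral_add]
  · refine intervalIntegral.integral_congr fun x _ => ?_
    simp only [antideriv_add, antideriv_smul]
    ring
  all_goals exact Continuous.intervalIntegrable (by fun_prop) _ _

/-- The Lagrange multiplier. -/
noncomputable def multiplier (f : UnitL2) : ℝ :=
  (3 * f.cubic - 2 * ‖f‖ ^ 2) / (2 * f.normSq)

/-- The weak Euler–Lagrange equation. -/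
theorem inner_eq_of_maximizer {f : UnitL2} (hc : 0 < f.normSq)
    (hmax : ∀ g : UnitL2, g.normSq = f.normSq → g.cubic - ‖g‖ ^ 2 ≤ f.cubic - ‖f‖ ^ 2)
    (h : UnitL2) : inner ℝ f h = ∫ x in (0:ℝ)..1,
      (3 / 2 * f.antideriv x ^ 2 - f.multiplier * f.antideriv x) * h.antideriv x := by
  have hcf := f.continuous_antideriv
  have hch := h.continuous_antideriv
  have hquad : ∀ a b d e : ℝ,
      HasDerivAt (fun t : ℝ => a + t * b + t ^ 2 * d + t ^ 3 * e) b 0 := fun a b d e => by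
    refine (((((hasDerivAt_id (0:ℝ)).mul_const b).const_add a).add
      (((hasDerivAt_id (0:ℝ)).pow 2).mul_const d)).add
      (((hasDerivAt_id (0:ℝ)).pow 3).mul_const e)).congr_deriv ?_
    simp
  have hN : HasDerivAt (fun t : ℝ => (f + t • h).normSq)
      (2 * ∫ x in (0:ℝ)..1, f.antideriv x * h.antideriv x) 0 := by
    simp only [normSq_add_smul]
    simpa using hquad f.normSq (2 * ∫ x in (0:ℝ)..1, f.antideriv x * h.antideriv x) h.normSq 0
  have hA : HasDerivAt (fun t : ℝ => (f + t • h).cubic)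
      (3 * ∫ x in (0:ℝ)..1, f.antideriv x ^ 2 * h.antideriv x) 0 := by
    simp only [cubic_add_smul]
    exact hquad _ _ _ _
  have hD : HasDerivAt (fun t : ℝ => ‖f + t • h‖ ^ 2) (2 * inner ℝ f h) 0 := by
    have : ∀ t : ℝ, ‖f + t • h‖ ^ 2 = ‖f‖ ^ 2 + t * (2 * inner ℝ f h) + t ^ 2 * ‖h‖ ^ 2 :=
      fun t => by
        rw [norm_add_sq_real, inner_smul_right, norm_smul, mul_pow, Real.norm_eq_abs, sq_abs]
        ring
    simp only [this]
    simpa using hquad (‖f‖ ^ 2) (2 * inner ℝ f h) (‖h‖ ^ 2) 0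
  have key := eq_of_isLocalMax_normalized (N := fun t : ℝ => (f + t • h).normSq)
    (A := fun t : ℝ => (f + t • h).cubic) (D := fun t : ℝ => ‖f + t • h‖ ^ 2)
    (by simpa using hc) hN hA hD fun t ht => by
      simp only [zero_smul, add_zero] at ht ⊢
      have := hmax (√(f.normSq / (f + t • h).normSq) • (f + t • h)) (by
        rw [normSq_smul, sq_sqrt (by positivity)]
        field_simp)
      rwa [cubic_smul, norm_smul, mul_pow, Real.norm_eq_abs, sq_abs] at this
  simp only [zero_smul, add_zero] at key
  rw [intervalIntegral.integral_congr (g := fun x => 3 / 2 * (f.antideriv x ^ 2 * h.antideriv x) -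
    f.multiplier * (f.antideriv x * h.antideriv x)) fun x _ => by ring,
    intervalIntegral.integral_sub, intervalIntegral.integral_const_mul,
    intervalIntegral.integral_const_mul, multiplier]
  · linarith
  all_goals exact Continuous.intervalIntegrable (by fun_prop) _ _

end UnitL2

theorem periodic_primitive {g : ℝ → ℝ} (hg : Continuous g) (hp : Function.Periodic g 1)
    (h0 : ∫ x in (0:ℝ)..1, g x = 0) : Function.Periodic (fun x => ∫ t in (0:ℝ)..x, g t) 1 := by
  intro x
  have h1 := hp.intervalIntegral_add_eq x 0
  rw [zero_add, h0] at h1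
  simp only
  rw [← integral_add_adjacent_intervals (hg.intervalIntegrable 0 x) (hg.intervalIntegrable x _),
    h1, add_zero]

theorem eq_of_periodic_of_eqOn {v w : ℝ → ℝ} (hv : Function.Periodic v 1)
    (hw : Function.Periodic w 1) (h : ∀ x ∈ Icc (0:ℝ) 1, v x = w x) : v = w := by
  funext x
  have h1 := hv.sub_zsmul_eq (x := x) ⌊x⌋
  have h2 := hw.sub_zsmul_eq (x := x) ⌊x⌋
  rw [← h1, ← h2]
  refine h _ ?_
  rw [zsmul_one, Int.self_sub_floor]
  exact ⟨Int.fract_nonneg x, (Int.fract_lt_one x).le⟩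

namespace UnitL2

/-- Integration by parts against the mean-free primitive. -/
theorem integral_mul_antideriv {p h : ℝ → ℝ} (hp : Continuous p) (hh : Continuous h) :
    ∫ x in (0:ℝ)..1, p x * (ofContinuous hh).antideriv x =
      ∫ x in (0:ℝ)..1, ((∫ y in (0:ℝ)..1, ∫ t in (0:ℝ)..y, (p t - ∫ s in (0:ℝ)..1, p s)) -
        ∫ t in (0:ℝ)..x, (p t - ∫ s in (0:ℝ)..1, p s)) * h x := by
  set m : ℝ := ∫ s in (0:ℝ)..1, p s with hm
  set P : ℝ → ℝ := fun x => ∫ t in (0:ℝ)..x, (p t - m) with hP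
  set hbar : ℝ := ∫ s in (0:ℝ)..1, h s with hhbar
  set η := (ofContinuous hh).antideriv with hη
  have hηc : Continuous η := continuous_antideriv _
  have hPd : ∀ x, HasDerivAt P (p x - m) x := fun x =>
    (hp.sub continuous_const).integral_hasStrictDerivAt 0 x |>.hasDerivAt
  have hPc : Continuous P := continuous_iff_continuousAt.2 fun x => (hPd x).continuousAt
  have hP1 : P 1 = 0 := by
    simp only [hP]
    rw [intervalIntegral.integral_sub (hp.intervalIntegrable _ _) (by simp)]
    simp [hm]
  have hP0 : P 0 = 0 := by simp [hP]
  set g : ℝ → ℝ := fun x => (∫ t in (0:ℝ)..x, h t) - x * hbar - (ofContinuous hh).offset with hg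
  have hgd : ∀ x, HasDerivAt g (h x - hbar) x := fun x => by
    refine ((((hh.integral_hasStrictDerivAt 0 x).hasDerivAt).sub
      ((hasDerivAt_id x).mul_const hbar)).sub_const _).congr_deriv ?_
    simp
  have hgη : ∀ x ∈ Icc (0:ℝ) 1, η x = g x := fun x hx => by
    simp only [hη, hg, antideriv]
    rw [prim_ofContinuous hh hx, prim_ofContinuous hh (right_mem_Icc.2 zero_le_one)]
  have hparts := integral_mul_deriv_eq_deriv_mul (u := g) (v := P) (a := 0) (b := 1)
    (fun x _ => hgd x) (fun x _ => hPd x)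
    ((hh.sub continuous_const).intervalIntegrable _ _)
    ((hp.sub continuous_const).intervalIntegrable _ _)
  rw [hP0, hP1] at hparts
  have e1 : ∫ x in (0:ℝ)..1, p x * η x = ∫ x in (0:ℝ)..1, g x * (p x - m) := by
    have : ∫ x in (0:ℝ)..1, m * η x = 0 := by
      rw [intervalIntegral.integral_const_mul, hη, integral_antideriv, mul_zero]
    have h2 : (∫ x in (0:ℝ)..1, p x * η x) - ∫ x in (0:ℝ)..1, m * η x =
        ∫ x in (0:ℝ)..1, g x * (p x - m) := by
      rw [← intervalIntegral.integral_sub (Continuous.intervalIntegrable (by fun_prop) _ _)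
        (Continuous.intervalIntegrable (by fun_prop) _ _)]
      refine intervalIntegral.integral_congr fun x hx => ?_
      rw [uIcc_of_le zero_le_one] at hx
      simp only [hgη x hx]
      ring
    rw [← h2, this, sub_zero]
  rw [e1, hparts]
  have e2 : ∫ x in (0:ℝ)..1, (h x - hbar) * P x =
      (∫ x in (0:ℝ)..1, P x * h x) - hbar * ∫ x in (0:ℝ)..1, P x := by
    rw [← intervalIntegral.integral_const_mul, ← intervalIntegral.integral_sub]
    · exact intervalIntegral.integral_congr fun x _ => by ring
    all_goals exact Continuous.intervalIntegrable (by fun_prop) _ _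
  have e3 : ∫ x in (0:ℝ)..1, ((∫ y in (0:ℝ)..1, P y) - P x) * h x =
      (∫ y in (0:ℝ)..1, P y) * hbar - ∫ x in (0:ℝ)..1, P x * h x := by
    rw [← intervalIntegral.integral_const_mul, ← intervalIntegral.integral_sub]
    · exact intervalIntegral.integral_congr fun x _ => by ring
    all_goals exact Continuous.intervalIntegrable (by fun_prop) _ _
  rw [e3, e2]
  ring

/-- An element is determined by its pairings with continuous functions. -/
theorem eq_of_inner_ofContinuous {f g : UnitL2}
    (h : ∀ (b : ℝ → ℝ) (hb : Continuous b),
      inner ℝ f (ofContinuous hb) = inner ℝ g (ofContinuous hb)) : f = g := by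
  have hd := BoundedContinuousFunction.toLp_denseRange (p := 2) ℝ unitMeasure ℝ (by norm_num)
  refine hd.eq_of_inner_left ℝ fun b => ?_
  have hb : BoundedContinuousFunction.toLp 2 unitMeasure ℝ b = ofContinuous b.continuous := by
    refine Lp.ext ?_
    exact (BoundedContinuousFunction.coeFn_toLp 2 unitMeasure ℝ b).trans
      (coeFn_ofContinuous b.continuous).symm
  rw [hb]
  exact h _ _

/-- Maximizers are smooth solutions of the Euler–Lagrange equation. -/
theorem exists_isCnoidal_of_maximizer {f : UnitL2} (hc : 0 < f.normSq)
    (hmax : ∀ g : UnitL2, g.normSq = f.normSq → g.cubic - ‖g‖ ^ 2 ≤ f.cubic - ‖f‖ ^ 2) :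
    ∃ (lam mu : ℝ) (w w' : ℝ → ℝ) (h : IsCnoidal lam mu w w'),
      f = ofContinuous h.continuous_deriv ∧ (∀ x ∈ Icc (0:ℝ) 1, f.antideriv x = w x) := by
  set w₀ : ℝ → ℝ := fun x => f.antideriv (Int.fract x) with hw₀
  have hw₀c : Continuous w₀ :=
    ContinuousOn.comp_fract'' f.continuous_antideriv.continuousOn f.antideriv_zero_eq_one
  have hw₀p : Function.Periodic w₀ 1 := fun x => by simp [hw₀]
  have hw₀e : ∀ x ∈ Icc (0:ℝ) 1, f.antideriv x = w₀ x := fun x hx => by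
    rcases hx.2.eq_or_lt with rfl | h1
    · simp [hw₀, f.antideriv_zero_eq_one]
    · simp only [hw₀, Int.fract_eq_self.2 ⟨hx.1, h1⟩]
  set p : ℝ → ℝ := fun x => 3 / 2 * w₀ x ^ 2 - f.multiplier * w₀ x with hp
  have hpc : Continuous p := by fun_prop
  have hpp : Function.Periodic p 1 := fun x => by simp only [hp, hw₀p x]
  set m : ℝ := ∫ s in (0:ℝ)..1, p s with hm
  set P : ℝ → ℝ := fun x => ∫ t in (0:ℝ)..x, (p t - m) with hP
  have hPp : Function.Periodic P 1 := by
    refine periodic_primitive (hpc.sub continuous_const) (fun x => by simp only [hpp x]) ?_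
    rw [intervalIntegral.integral_sub (hpc.intervalIntegrable _ _) (by simp)]
    simp [hm]
  have hPd : ∀ x, HasDerivAt P (p x - m) x := fun x =>
    (hpc.sub continuous_const).integral_hasStrictDerivAt 0 x |>.hasDerivAt
  have hPc : Continuous P := continuous_iff_continuousAt.2 fun x => (hPd x).continuousAt
  set q : ℝ → ℝ := fun x => (∫ y in (0:ℝ)..1, P y) - P x with hq
  have hqc : Continuous q := by fun_prop
  have hqp : Function.Periodic q 1 := fun x => by simp only [hq, hPp x]
  have hq0 : ∫ x in (0:ℝ)..1, q x = 0 := by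
    simp only [hq]
    rw [intervalIntegral.integral_sub (by simp) (hPc.intervalIntegrable _ _)]
    simp
  have hfq : f = ofContinuous hqc := by
    refine eq_of_inner_ofContinuous fun b hb => ?_
    rw [inner_eq_of_maximizer hc hmax, inner_ofContinuous hqc hb,
      ← integral_mul_antideriv hpc hb]
    refine intervalIntegral.integral_congr fun x hx => ?_
    rw [uIcc_of_le zero_le_one] at hx
    simp only [hp, hw₀e x hx]
  set w : ℝ → ℝ := fun x => f.antideriv 0 + ∫ t in (0:ℝ)..x, q t with hw
  have hwp : Function.Periodic w 1 := fun x => by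
    have := periodic_primitive hqc hqp hq0 x
    simp only [hw] at this ⊢
    rw [this]
  have hwe : ∀ x ∈ Icc (0:ℝ) 1, f.antideriv x = w x := fun x hx => by
    have h1 : f.prim 1 = 0 := by
      conv_lhs => rw [hfq]
      rw [prim_ofContinuous hqc (right_mem_Icc.2 zero_le_one), hq0]
    have h2 : f.prim x = ∫ t in (0:ℝ)..x, q t := by
      conv_lhs => rw [hfq]
      rw [prim_ofContinuous hqc hx]
    simp only [hw, antideriv, h1, h2, prim_zero_right]
    ring
  have hww : w₀ = w := eq_of_periodic_of_eqOn hw₀p hwp fun x hx => by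
    rw [← hw₀e x hx, hwe x hx]
  refine ⟨f.multiplier, m, w, q, ⟨fun x => ?_, fun x => ?_, hwp⟩, hfq, hwe⟩
  · exact ((hqc.integral_hasStrictDerivAt 0 x).hasDerivAt).const_add _
  · refine ((hPd x).const_sub _).congr_deriv ?_
    simp only [hp, hww]
    ring

end UnitL2

/-- Admissible functions: mean-free periodic `C¹` functions with prescribed square norm. -/
structure IsAdmissible (c : ℝ) (v v' : ℝ → ℝ) : Prop where
  hasDeriv : ∀ x, HasDerivAt v (v' x) x
  continuous_deriv : Continuous v'
  periodic : Function.Periodic v 1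
  integral_eq_zero : ∫ x in (0:ℝ)..1, v x = 0
  integral_sq : ∫ x in (0:ℝ)..1, v x ^ 2 = c

/-- Maximizers of the enstrophy rate in terms of `v = -u'`. -/
structure IsMaximizer (c : ℝ) (w w' : ℝ → ℝ) : Prop extends IsAdmissible c w w' where
  le : ∀ v v' : ℝ → ℝ, IsAdmissible c v v' →
    ∫ x in (0:ℝ)..1, (v x ^ 3 - v' x ^ 2) ≤ ∫ x in (0:ℝ)..1, (w x ^ 3 - w' x ^ 2)

namespace IsAdmissible

variable {c : ℝ} {v v' : ℝ → ℝ}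

theorem continuous (h : IsAdmissible c v v') : Continuous v :=
  continuous_iff_continuousAt.2 fun x => (h.hasDeriv x).continuousAt

theorem antideriv_eq (h : IsAdmissible c v v') {x : ℝ} (hx : x ∈ Icc (0:ℝ) 1) :
    (UnitL2.ofContinuous h.continuous_deriv).antideriv x = v x :=
  UnitL2.antideriv_ofContinuous h.hasDeriv h.continuous_deriv (by simpa using h.periodic 0)
    h.integral_eq_zero hx

theorem normSq_eq (h : IsAdmissible c v v') :
    (UnitL2.ofContinuous h.continuous_deriv).normSq = c := by
  refine Eq.trans ?_ h.integral_sq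
  refine intervalIntegral.integral_congr fun x hx => ?_
  rw [uIcc_of_le zero_le_one] at hx
  simp only [h.antideriv_eq hx]

theorem cubic_sub_eq (h : IsAdmissible c v v') :
    (UnitL2.ofContinuous h.continuous_deriv).cubic -
      ‖UnitL2.ofContinuous h.continuous_deriv‖ ^ 2 =
    ∫ x in (0:ℝ)..1, (v x ^ 3 - v' x ^ 2) := by
  have h1 := h.continuous
  have h2 := h.continuous_deriv
  rw [intervalIntegral.integral_sub (Continuous.intervalIntegrable (by fun_prop) _ _)
    (Continuous.intervalIntegrable (by fun_prop) _ _), ← real_inner_self_eq_norm_sq,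
    UnitL2.inner_ofContinuous]
  congr 1
  · refine intervalIntegral.integral_congr fun x hx => ?_
    rw [uIcc_of_le zero_le_one] at hx
    simp only [h.antideriv_eq hx]
  · simp only [sq]

end IsAdmissible

theorem UnitL2.isMaximizer_of_maximizer {c lam mu : ℝ} {f : UnitL2} {w w' : ℝ → ℝ}
    (h : IsCnoidal lam mu w w') (hf : f = UnitL2.ofContinuous h.continuous_deriv)
    (hfw : ∀ x ∈ Icc (0:ℝ) 1, f.antideriv x = w x) (hfc : f.normSq = c)
    (hmax : ∀ g : UnitL2, g.normSq = c → g.cubic - ‖g‖ ^ 2 ≤ f.cubic - ‖f‖ ^ 2) :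
    IsMaximizer c w w' := by
  have hadm : IsAdmissible c w w' := by
    refine ⟨h.hasDeriv, h.continuous_deriv, h.periodic, ?_, ?_⟩
    · refine Eq.trans ?_ f.integral_antideriv
      refine intervalIntegral.integral_congr fun x hx => ?_
      rw [uIcc_of_le zero_le_one] at hx
      exact (hfw x hx).symm
    · rw [← hfc]
      refine intervalIntegral.integral_congr fun x hx => ?_
      rw [uIcc_of_le zero_le_one] at hx
      simp only [hfw x hx]
  refine ⟨hadm, fun v v' hv => ?_⟩
  rw [← hv.cubic_sub_eq, ← hadm.cubic_sub_eq, ← hf]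
  exact hmax _ hv.normSq_eq

/-- Existence of maximizers. -/
theorem exists_isMaximizer {c : ℝ} (hc : 0 < c) :
    ∃ (lam mu : ℝ) (w w' : ℝ → ℝ), IsCnoidal lam mu w w' ∧ IsMaximizer c w w' := by
  obtain ⟨f, hfc, hmax⟩ := UnitL2.exists_maximizer hc
  obtain ⟨lam, mu, w, w', h, hf, hfw⟩ := UnitL2.exists_isCnoidal_of_maximizer (f := f)
    (by rwa [hfc]) (by rwa [hfc])
  exact ⟨lam, mu, w, w', h, UnitL2.isMaximizer_of_maximizer h hf hfw hfc hmax⟩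

/-- Every `C¹` maximizer solves the Euler–Lagrange equation. -/
theorem IsMaximizer.exists_isCnoidal {c : ℝ} {w w' : ℝ → ℝ} (hc : 0 < c)
    (hw : IsMaximizer c w w') : ∃ lam mu : ℝ, IsCnoidal lam mu w w' := by
  obtain ⟨f, hfc, hmax⟩ := UnitL2.exists_maximizer hc
  obtain ⟨lam₀, mu₀, v, v', hv, hf, hfv⟩ := UnitL2.exists_isCnoidal_of_maximizer (f := f)
    (by rwa [hfc]) (by rwa [hfc])
  have hvmax := UnitL2.isMaximizer_of_maximizer hv hf hfv hfc hmax
  set F := UnitL2.ofContinuous hw.continuous_deriv with hF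
  have hle := hw.le v v' hvmax.toIsAdmissible
  rw [← hw.cubic_sub_eq, ← hvmax.cubic_sub_eq, ← hf, ← hF] at hle
  obtain ⟨lam, mu, z, z', hz, hFz, hFz'⟩ := UnitL2.exists_isCnoidal_of_maximizer (f := F)
    (by rwa [hw.normSq_eq]) (fun g hg => (hmax g (by rw [hg, hw.normSq_eq])).trans hle)
  have hwz : w = z := eq_of_periodic_of_eqOn hw.periodic hz.periodic fun x hx => by
    rw [← hFz' x hx, ← hw.antideriv_eq hx]
  subst hwz
  have hwz' : w' = z' := funext fun x => (hw.hasDeriv x).unique (hz.hasDeriv x)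
  subst hwz'
  exact ⟨lam, mu, hz⟩

namespace IsCnoidal

variable {lam mu : ℝ} {w w' : ℝ → ℝ}

/-- The virial identity. -/
theorem integral_deriv_sq (h : IsCnoidal lam mu w w') (h0 : ∫ x in (0:ℝ)..1, w x = 0) :
    ∫ x in (0:ℝ)..1, w' x ^ 2 =
      3 / 2 * (∫ x in (0:ℝ)..1, w x ^ 3) - lam * ∫ x in (0:ℝ)..1, w x ^ 2 := by
  have hc := h.continuous
  have hc' := h.continuous_deriv
  have hparts := integral_mul_deriv_eq_deriv_mul (u := w) (v := w') (a := 0) (b := 1)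
    (fun x _ => h.hasDeriv x) (fun x _ => h.hasDeriv₂ x)
    (hc'.intervalIntegrable _ _) (Continuous.intervalIntegrable (by fun_prop) _ _)
  have e1 : w 1 = w 0 := by simpa using h.periodic 0
  have e2 : w' 1 = w' 0 := by simpa using h.periodic_deriv 0
  rw [e1, e2, sub_self, zero_sub] at hparts
  rw [intervalIntegral.integral_congr (g := fun x => w' x * w' x) fun x _ => sq _]
  have : ∫ x in (0:ℝ)..1, w x * (-(3 / 2) * w x ^ 2 + lam * w x + mu) =
      -(3 / 2) * (∫ x in (0:ℝ)..1, w x ^ 3) + lam * (∫ x in (0:ℝ)..1, w x ^ 2) +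
        mu * ∫ x in (0:ℝ)..1, w x := by
    rw [← intervalIntegral.integral_const_mul, ← intervalIntegral.integral_const_mul,
      ← intervalIntegral.integral_const_mul, ← intervalIntegral.integral_add,
      ← intervalIntegral.integral_add]
    · exact intervalIntegral.integral_congr fun x _ => by ring
    all_goals exact Continuous.intervalIntegrable (by fun_prop) _ _
  rw [h0, hparts] at this
  linarith

/-- The enstrophy rate of a mean-free cnoidal wave in terms of its first integral at a critical
point. -/
theorem integral_rate (h : IsCnoidal lam mu w w') (h0 : ∫ x in (0:ℝ)..1, w x = 0) {a : ℝ}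
    (ha : w' a = 0) :
    ∫ x in (0:ℝ)..1, (w x ^ 3 - w' x ^ 2) = (3 * lam * (∫ x in (0:ℝ)..1, w x ^ 2) -
      (w a ^ 3 - lam * w a ^ 2 - 2 * mu * w a)) / 5 := by
  have hc := h.continuous
  have hc' := h.continuous_deriv
  obtain ⟨e, he⟩ := h.exists_energy
  have h1 := h.integral_deriv_sq h0
  have h2 : ∫ x in (0:ℝ)..1, w' x ^ 2 = -(∫ x in (0:ℝ)..1, w x ^ 3) +
      lam * (∫ x in (0:ℝ)..1, w x ^ 2) + 2 * mu * (∫ x in (0:ℝ)..1, w x) + e := by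
    have : e = ∫ x in (0:ℝ)..1, e := by simp
    conv_rhs => rw [this]
    rw [← intervalIntegral.integral_const_mul, ← intervalIntegral.integral_const_mul,
      ← intervalIntegral.integral_neg, ← intervalIntegral.integral_add,
      ← intervalIntegral.integral_add, ← intervalIntegral.integral_add]
    · exact intervalIntegral.integral_congr fun x _ => by simp only [he]
    all_goals exact Continuous.intervalIntegrable (by fun_prop) _ _
  have h3 := he a
  rw [ha] at h3
  rw [h0] at h2
  rw [intervalIntegral.integral_sub (Continuous.intervalIntegrable (by fun_prop) _ _)
    (Continuous.intervalIntegrable (by fun_prop) _ _)]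
  linarith

end IsCnoidal

theorem sq_mul_exp_neg_le {k : ℝ} (hk : 0 ≤ k) : k ^ 2 * rexp (-k) ≤ 2 := by
  have := quadratic_le_exp_of_nonneg hk
  rw [exp_neg, ← div_eq_mul_inv, div_le_iff₀ (exp_pos k)]
  nlinarith

theorem crestWave_half_mem {k : ℝ} (hk : 1 ≤ k) :
    -(8 * k) ≤ crestWave k (1 / 2) ∧ crestWave k (1 / 2) ≤ -(8 * k) + 112 := by
  have h1 := sechSum_sub_mem hk (x := 1 / 2) (by rw [abs_of_pos (by norm_num)])
  have h2 := sechSq_le_exp (k * (1 / 2))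
  have h3 := sechSq_pos (k * (1 / 2))
  have h4 : -2 * |k * (1 / 2)| = -k := by rw [abs_of_pos (by positivity)]; ring
  rw [h4] at h2
  have h5 := sq_mul_exp_neg_le (k := k) (by linarith)
  rw [crestWave]
  constructor
  · nlinarith [sq_nonneg k]
  · nlinarith [sq_nonneg k]

/-- Twice the enstrophy is `64/3 k³` to leading order. -/
theorem abs_crestNormSq_sub_le {k : ℝ} (hk : 100 ≤ k) :
    |crestNormSq k - (64 / 3 * k ^ 3 - 64 * k ^ 2)| ≤ 12288 := by
  have := abs_interactionSum_le (k := k) (by linarith)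
  rw [crestNormSq, add_sub_cancel_left, abs_mul, abs_of_pos (by norm_num)]
  linarith

theorem abs_rate_sub_le_of_bounds {k L N b : ℝ} (hk : 100 ≤ k) (hL1 : 4 * k ^ 2 - 25 * k ≤ L)
    (hL2 : L ≤ 4 * k ^ 2) (hN1 : 64 / 3 * k ^ 3 - 66 * k ^ 2 ≤ N) (hN2 : N ≤ 64 / 3 * k ^ 3)
    (hm1 : -(8 * k) ≤ b) (hb : b ≤ 0) :
    |(3 * L * N - (b ^ 3 - L * b ^ 2 - 3 * N * b)) / 5 - 256 / 5 * k ^ 5| ≤ 600 * k ^ 4 := by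
  have hk0 : 0 < k := by linarith
  have hL0 : 0 ≤ 4 * k ^ 2 - 25 * k := by nlinarith
  have hN0 : 0 ≤ 64 / 3 * k ^ 3 - 66 * k ^ 2 := by nlinarith [sq_nonneg k, pow_pos hk0 2]
  have hb2 : b ^ 2 ≤ 64 * k ^ 2 := by nlinarith
  have hb3 : -(512 * k ^ 3) ≤ b ^ 3 := by
    nlinarith [mul_nonneg (neg_nonneg.2 hb) (sub_nonneg.2 hb2), pow_pos hk0 2]
  have hb3' : b ^ 3 ≤ 0 := by nlinarith [mul_nonneg (neg_nonneg.2 hb) (sq_nonneg b)]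
  have hk4 : 100 * k ^ 3 ≤ k ^ 4 := by nlinarith [pow_pos hk0 3]
  have hk4' : 0 ≤ k ^ 3 := by positivity
  have p1 : L * N ≤ 4 * k ^ 2 * (64 / 3 * k ^ 3) :=
    mul_le_mul hL2 hN2 (by linarith) (by positivity)
  have p2 : (4 * k ^ 2 - 25 * k) * (64 / 3 * k ^ 3 - 66 * k ^ 2) ≤ L * N :=
    mul_le_mul hL1 hN1 hN0 (by linarith)
  have p3 : L * b ^ 2 ≤ 4 * k ^ 2 * (64 * k ^ 2) :=
    mul_le_mul hL2 hb2 (sq_nonneg b) (by positivity)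
  have p4 : 0 ≤ L * b ^ 2 := mul_nonneg (by linarith) (sq_nonneg b)
  have p5 : N * -b ≤ 64 / 3 * k ^ 3 * (8 * k) :=
    mul_le_mul hN2 (by linarith) (by linarith) (by positivity)
  have p6 : 0 ≤ N * -b := mul_nonneg (by linarith) (by linarith)
  rw [abs_le]
  constructor <;> nlinarith

/-- The enstrophy rate of the crest wave. -/
theorem abs_rate_crestWave_sub_le {k : ℝ} (hk : 100 ≤ k) :
    |(∫ x in (0:ℝ)..1, (crestWave k x ^ 3 - (4 * k ^ 2 * sechSum' k x) ^ 2)) -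
      256 / 5 * k ^ 5| ≤ 600 * k ^ 4 := by
  have hk0 : 0 < k := by linarith
  have hw := isCnoidal_crestWave hk0
  have h0 := integral_crestWave hk0
  obtain ⟨M, m, r, hs, -, -⟩ := isSingleCrest_crestWave hk
  have ha : 4 * k ^ 2 * sechSum' k (1 / 2) = 0 :=
    hw.deriv_eq_zero_of_min (a := 1 / 2) fun x => by rw [hs.trough]; exact hs.ge x
  have hrate := hw.integral_rate h0 ha
  have hmu := hw.integral_sq h0
  rw [integral_crestWave_sq hk0] at hrate hmu
  have hA := mul_nonneg (sq_nonneg k) (cschSum_nonneg k)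
  have hA2 := sq_mul_cschSum_le hk0
  have hN := abs_le.1 (abs_crestNormSq_sub_le hk)
  obtain ⟨hm1, hm2⟩ := crestWave_half_mem (k := k) (by linarith)
  have hk2 : 10000 ≤ k ^ 2 := by nlinarith
  refine le_of_eq_of_le ?_ (abs_rate_sub_le_of_bounds hk
    (L := 4 * k ^ 2 - 24 * k - 24 * k ^ 2 * cschSum k) (N := crestNormSq k)
    (b := crestWave k (1 / 2)) (by linarith) (by linarith) (by linarith) (by linarith)
    hm1 (by linarith))
  rw [hrate]
  congr 2
  rw [hmu]
  ring

/-- A wave with at least two crests per unit length and sign changes has large dissipation. -/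
theorem four_mul_sq_le_of_short_period {w w' : ℝ → ℝ} (hw : ∀ x, HasDerivAt w (w' x) x)
    (hw' : Continuous w') {p : ℝ} (hp : 0 < p) (hp2 : p ≤ 1 / 2) (hper : Function.Periodic w p)
    (h0 : 0 < w 0) (hneg : ∃ x, w x ≤ 0) {η : ℝ} (hη : 0 < η) :
    4 * w 0 ^ 2 ≤ η * (∫ x in (0:ℝ)..1, w x ^ 2) + (∫ x in (0:ℝ)..1, w' x ^ 2) / η := by
  have hc : Continuous w := continuous_iff_continuousAt.2 fun x => (hw x).continuousAt
  have hper' : Function.Periodic w' p := fun x => by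
    have h1 := (hw (x + p)).comp_add_const x p
    simp only [hper _] at h1
    exact h1.unique (hw x)
  set G : ℝ → ℝ := fun x => η * w x ^ 2 + w' x ^ 2 / η with hG
  have hGc : Continuous G := by fun_prop
  have hG0 : ∀ x, 0 ≤ G x := fun x => by positivity
  have hi : ∀ a b, IntervalIntegrable G volume a b := fun a b => hGc.intervalIntegrable a b
  have hGw : ∀ x, |2 * (w x * w' x)| ≤ G x := fun x => by
    have e : G x = (η * w x ^ 2 * η + w' x ^ 2) / η := by simp only [hG]; field_simp
    rw [e, le_div_iff₀ hη, ← abs_of_pos hη, ← abs_mul, abs_of_pos hη, abs_le]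
    constructor
    · nlinarith [sq_nonneg (η * w x + w' x)]
    · nlinarith [sq_nonneg (η * w x - w' x)]
  obtain ⟨x₁, hx₁⟩ := hneg
  obtain ⟨y, hy, hxy⟩ := hper.exists_mem_Ico₀ hp x₁
  obtain ⟨z, hz, hwz⟩ := intermediate_value_Icc' hy.1 hc.continuousOn
    (show (0:ℝ) ∈ Icc (w y) (w 0) from ⟨hxy ▸ hx₁, h0.le⟩)
  have hzp : z ≤ p := hz.2.trans hy.2.le
  have hftc : ∀ a b, ∫ x in a..b, 2 * (w x * w' x) = w b ^ 2 - w a ^ 2 := fun a b => by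
    refine integral_eq_sub_of_hasDerivAt (f := fun x => w x ^ 2) (fun x _ => ?_)
      (Continuous.intervalIntegrable (by fun_prop) _ _)
    exact ((hw x).pow 2).congr_deriv (by simp; ring)
  have hle : ∀ a b, a ≤ b → |w b ^ 2 - w a ^ 2| ≤ ∫ x in a..b, G x := fun a b hab => by
    rw [← hftc]
    exact (abs_integral_le_integral_abs hab).trans
      (integral_mono hab (Continuous.intervalIntegrable (by fun_prop) _ _) (hi _ _) hGw)
  have hwp : w p = w 0 := by simpa using hper 0
  have i1 := hle 0 z hz.1
  have i2 := hle z p hzp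
  rw [hwz, zero_pow two_ne_zero, zero_sub, abs_neg, abs_of_nonneg (sq_nonneg _)] at i1
  rw [hwz, zero_pow two_ne_zero, sub_zero, hwp, abs_of_nonneg (sq_nonneg _)] at i2
  have i3 := integral_add_adjacent_intervals (hi 0 z) (hi z p)
  have hGp : Function.Periodic G p := fun x => by simp only [hG, hper x, hper' x]
  have i4 := hGp.intervalIntegral_add_eq p 0
  have i5 := integral_add_adjacent_intervals (hi 0 p) (hi p (p + p))
  have i6 : ∫ x in (0:ℝ)..(p + p), G x ≤ ∫ x in (0:ℝ)..1, G x :=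
    integral_mono_interval le_rfl (by linarith) (by linarith)
      (Filter.Eventually.of_forall hG0) (hi 0 1)
  have i7 : ∫ x in (0:ℝ)..1, G x =
      η * (∫ x in (0:ℝ)..1, w x ^ 2) + (∫ x in (0:ℝ)..1, w' x ^ 2) / η := by
    simp only [hG]
    rw [intervalIntegral.integral_add (Continuous.intervalIntegrable (by fun_prop) _ _)
      (Continuous.intervalIntegrable (by fun_prop) _ _), intervalIntegral.integral_const_mul,
      intervalIntegral.integral_div]
  rw [zero_add] at i4
  rw [← i7]
  linarith

theorem isAdmissible_crestWave {k : ℝ} (hk : 0 < k) :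
    IsAdmissible (crestNormSq k) (crestWave k) (fun x => 4 * k ^ 2 * sechSum' k x) :=
  have h := isCnoidal_crestWave hk
  ⟨h.hasDeriv, h.continuous_deriv, h.periodic, integral_crestWave hk, integral_crestWave_sq hk⟩

namespace IsMaximizer

variable {c : ℝ} {w w' : ℝ → ℝ}

/-- Maximizers have exactly one crest per period. -/
theorem not_short_period {k : ℝ} (hk : 1000 ≤ k) (hw : IsMaximizer (crestNormSq k) w w')
    (hM : ∀ x, w x ≤ w 0) (h0 : 0 < w 0) (hneg : ∃ x, w x ≤ 0) {p : ℝ} (hp : 0 < p)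
    (hp2 : p ≤ 1 / 2) (hper : Function.Periodic w p) : False := by
  have hk0 : 0 < k := by linarith
  have hc := hw.continuous
  have hc' := hw.continuous_deriv
  have h1 := four_mul_sq_le_of_short_period hw.hasDeriv hc' hp hp2 hper h0 hneg
    (η := 7 / 8 * k) (by positivity)
  have h2 := hw.le _ _ (isAdmissible_crestWave hk0)
  have h3 := (abs_le.1 (abs_rate_crestWave_sub_le (k := k) (by linarith))).1
  have h4 := (abs_le.1 (abs_crestNormSq_sub_le (k := k) (by linarith)))
  have h5 : ∫ x in (0:ℝ)..1, w x ^ 3 ≤ w 0 * crestNormSq k := by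
    rw [← hw.integral_sq, ← intervalIntegral.integral_const_mul]
    refine integral_mono zero_le_one (Continuous.intervalIntegrable (by fun_prop) _ _)
      (Continuous.intervalIntegrable (by fun_prop) _ _) fun x => ?_
    have := mul_le_mul_of_nonneg_right (hM x) (sq_nonneg (w x))
    simp only
    linarith
  rw [intervalIntegral.integral_sub (f := fun x => w x ^ 3)
    (Continuous.intervalIntegrable (by fun_prop) _ _)
    (Continuous.intervalIntegrable (by fun_prop) _ _)] at h2
  rw [hw.integral_sq] at h1
  set N := crestNormSq k
  set D := ∫ x in (0:ℝ)..1, w' x ^ 2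
  set T := ∫ x in (0:ℝ)..1, w x ^ 3
  set R := ∫ x in (0:ℝ)..1, (crestWave k x ^ 3 - (4 * k ^ 2 * sechSum' k x) ^ 2)
  set M := w 0
  have hN0 : 0 ≤ N := by
    have := pow_pos hk0 2
    nlinarith
  have hN1 : N ≤ 64 / 3 * k ^ 3 := by nlinarith
  clear_value N D T R M
  have h6 : 7 / 8 * k * (4 * M ^ 2 - 7 / 8 * k * N) ≤ D := by
    have : 4 * M ^ 2 - 7 / 8 * k * N ≤ D / (7 / 8 * k) := by linarith
    rw [le_div_iff₀ (by positivity)] at this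
    linarith
  have h7 : R ≤ M * N - 7 / 8 * k * (4 * M ^ 2 - 7 / 8 * k * N) := by linarith
  have h8 : 14 * k * R ≤ N ^ 2 + 14 * k * (49 / 64 * k ^ 2 * N) := by
    have := mul_le_mul_of_nonneg_left h7 (show 0 ≤ 14 * k by positivity)
    nlinarith [sq_nonneg (7 * k * M - N)]
  have h9 : N ^ 2 ≤ (64 / 3 * k ^ 3) ^ 2 := by gcongr
  have h10 : 14 * k * (49 / 64 * k ^ 2 * N) ≤ 14 * k * (49 / 64 * k ^ 2 * (64 / 3 * k ^ 3)) := by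
    gcongr
  have h11 : 14 * k * (256 / 5 * k ^ 5 - 600 * k ^ 4) ≤ 14 * k * R := by
    gcongr
    linarith
  have h12 : 1000 * k ^ 5 ≤ k ^ 6 := by nlinarith [pow_pos hk0 5]
  nlinarith [pow_pos hk0 5]

/-- A maximizer with a crest at the origin is a crest wave. -/
theorem eq_crestWave {s : ℝ} (hs : 1000 ≤ s) (hw : IsMaximizer (crestNormSq s) w w')
    (hd : w' 0 = 0) (h0 : 0 < w 0) :
    ∃ k, 100 ≤ k ∧ crestNormSq k = crestNormSq s ∧ w = crestWave k := by
  have hs0 : 0 < s := by linarith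
  have hc := hw.continuous
  have hN := (abs_le.1 (abs_crestNormSq_sub_le (k := s) (by linarith)))
  have hNpos : 0 < crestNormSq s := by
    have := pow_pos hs0 2
    nlinarith
  obtain ⟨lam, mu, hcn⟩ := hw.exists_isCnoidal hNpos
  have hneg : ∃ x, w x ≤ 0 := by
    by_contra! hpos
    have := intervalIntegral_pos_of_pos (f := w) (hc.intervalIntegrable 0 1) hpos zero_lt_one
    exact this.ne' hw.integral_eq_zero
  obtain ⟨x₀, hx₀⟩ := hneg
  obtain ⟨M, m, r, hrm, hmM, ⟨xM, hxM⟩, ⟨xm, hxm⟩, hM, hm, hlam, hfac⟩ :=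
    hcn.exists_roots ⟨0, x₀, (hx₀.trans_lt h0).ne'⟩
  have hm0 : m ≤ 0 := (hm x₀).trans hx₀
  have h0M : w 0 = M := by
    refine (IsCnoidal.eq_max_or_eq_min hrm hm hfac hd).resolve_right fun h => ?_
    linarith
  have hcrest : IsSingleCrest M m r w w' := by
    rcases hcn.short_period_or_monotone hrm hmM h0M hM hm hfac with ⟨p, hp, hp2, hper⟩ | ⟨hanti, ht⟩
    · exact (hw.not_short_period hs (fun x => h0M ▸ hM x) h0 ⟨x₀, hx₀⟩ hp hp2 hper).elim
    · exact ⟨hrm, hmM, h0M, ht, hM, hm, hanti, hfac⟩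
  have hamp : crestAmplitude 100 ≤ M - m := by
    have h1 : crestNormSq s ≤ (M - m) ^ 2 := by
      have := integral_mono (a := 0) (b := 1) (μ := volume) (f := fun x => w x ^ 2)
        (g := fun _ => (M - m) ^ 2) zero_le_one
        (Continuous.intervalIntegrable (by fun_prop) _ _) (by simp) fun x => by
          have := hM x
          have := hm x
          simp only
          nlinarith
      rw [hw.integral_sq] at this
      simpa using this
    have h2 : crestAmplitude 100 ≤ 80000 := by
      have h3 := (sechSum_sub_mem (k := 100) (by norm_num) (x := 0) (by norm_num)).2
      have h4 := (sechSum_sub_mem (k := 100) (by norm_num) (x := 1 / 2)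
        (by rw [abs_of_pos (by norm_num)])).1
      have h5 := sechSq_pos (100 * (1 / 2))
      have h6 := sechSq_le_one (100 * 0)
      have h7 : 10 * rexp (-100) ≤ 1 := by
        have := add_one_le_exp (100:ℝ)
        rw [exp_neg, ← div_eq_mul_inv, div_le_one (exp_pos _)]
        linarith
      rw [crestAmplitude]
      linarith
    refine h2.trans (abs_le_of_sq_le_sq' ?_ (by linarith)).2
    have h3 : 1000 ^ 2 * s ≤ s ^ 3 := by nlinarith [sq_nonneg s]
    nlinarith [sq_nonneg s]
  obtain ⟨k, hk, hkamp⟩ := exists_crestAmplitude_eq hamp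
  obtain ⟨M₂, m₂, r₂, hcrest₂, hlam₂, hamp₂⟩ := isSingleCrest_crestWave hk
  have hk0 : 0 < k := by linarith
  have heq := IsCnoidal.eq_of_amplitude hcn (isCnoidal_crestWave hk0) hcrest hcrest₂ hlam hlam₂
    (hkamp.symm.trans hamp₂.symm)
  have hshift : M - M₂ = 0 := by
    have h1 := hw.integral_eq_zero
    simp only [heq] at h1
    rw [intervalIntegral.integral_add
      ((isCnoidal_crestWave hk0).continuous.intervalIntegrable _ _) (by simp),
      integral_crestWave hk0] at h1
    simpa using h1
  have hwk : w = crestWave k := funext fun x => by rw [heq x, hshift, add_zero]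
  refine ⟨k, hk, ?_, hwk⟩
  rw [← hw.integral_sq, ← integral_crestWave_sq hk0, hwk]

end IsMaximizer

theorem IsMaximizer.translate {c : ℝ} {w w' : ℝ → ℝ} (hw : IsMaximizer c w w') (a : ℝ) :
    IsMaximizer c (fun x => w (x + a)) (fun x => w' (x + a)) := by
  have hper' : Function.Periodic w' 1 := fun x => by
    have h1 := (hw.hasDeriv (x + 1)).comp_add_const x 1
    simp only [hw.periodic _] at h1
    exact h1.unique (hw.hasDeriv x)
  have hshift : ∀ f : ℝ → ℝ, Function.Periodic f 1 →
      ∫ x in (0:ℝ)..1, f (x + a) = ∫ x in (0:ℝ)..1, f x := fun f hf => by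
    rw [intervalIntegral.integral_comp_add_right]
    simpa [add_comm] using hf.intervalIntegral_add_eq a 0
  refine ⟨⟨fun x => (hw.hasDeriv (x + a)).comp_add_const x a,
    hw.continuous_deriv.comp (continuous_add_const a), fun x => ?_, ?_, ?_⟩, fun v v' hv => ?_⟩
  · rw [add_right_comm, hw.periodic]
  · rw [hshift w hw.periodic, hw.integral_eq_zero]
  · rw [hshift (fun x => w x ^ 2) fun x => by simp only [hw.periodic x], hw.integral_sq]
  · rw [hshift (fun x => w x ^ 3 - w' x ^ 2) fun x => by simp only [hw.periodic x, hper' x]]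
    exact hw.le v v' hv

theorem IsMaximizer.eq_crestWave_self {s : ℝ} {w w' : ℝ → ℝ} (hs : 1000 ≤ s)
    (hw : IsMaximizer (crestNormSq s) w w') (hd : w' 0 = 0) (h0 : 0 < w 0) : w = crestWave s := by
  obtain ⟨k, hk, hks, hwk⟩ := hw.eq_crestWave hs hd h0
  rcases lt_trichotomy k s with h | rfl | h
  · exact absurd hks (crestNormSq_lt hk h).ne
  · exact hwk
  · exact absurd hks (crestNormSq_lt (by linarith) h).ne.symm

/-- The crest wave maximizes the enstrophy rate. -/
theorem isMaximizer_crestWave {s : ℝ} (hs : 1000 ≤ s) :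
    IsMaximizer (crestNormSq s) (crestWave s) (fun x => 4 * s ^ 2 * sechSum' s x) := by
  have hs0 : 0 < s := by linarith
  have hN := (abs_le.1 (abs_crestNormSq_sub_le (k := s) (by linarith)))
  have hNpos : 0 < crestNormSq s := by
    have := pow_pos hs0 2
    nlinarith
  obtain ⟨lam, mu, w, w', hcn, hw⟩ := exists_isMaximizer hNpos
  obtain ⟨a, ha⟩ := hcn.exists_max
  have hpos : 0 < w a := by
    by_contra! hle
    obtain ⟨K, hK⟩ := hcn.exists_bound
    have hc := hw.continuous
    have := integral_mono (a := 0) (b := 1) (μ := volume) (f := fun x => w x ^ 2)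
      (g := fun x => -K * w x) zero_le_one (Continuous.intervalIntegrable (by fun_prop) _ _)
      (Continuous.intervalIntegrable (by fun_prop) _ _) fun x => by
        have h1 := (abs_le.1 (hK x)).1
        have h2 := (ha x).trans hle
        simp only
        nlinarith
    rw [hw.integral_sq, intervalIntegral.integral_const_mul, hw.integral_eq_zero] at this
    linarith
  have hwa := hw.translate a
  have heq := hwa.eq_crestWave_self hs (by simpa using hcn.deriv_eq_zero_of_max ha)
    (by simpa using hpos)
  rw [heq] at hwa
  have heq' : (fun x => w' (x + a)) = fun x => 4 * s ^ 2 * sechSum' s x :=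
    funext fun x => (hwa.hasDeriv x).unique ((isCnoidal_crestWave hs0).hasDeriv x)
  rwa [heq'] at hwa

section Bridge

variable {u : ℝ → ℝ}

theorem hasDerivAt_deriv_of_contDiff (hu : ContDiff ℝ 2 u) (x : ℝ) :
    HasDerivAt (deriv u) (deriv (deriv u) x) x :=
  ((hu.iterate_deriv' 1 1).differentiable one_ne_zero x).hasDerivAt

theorem continuous_deriv_deriv_of_contDiff (hu : ContDiff ℝ 2 u) :
    Continuous (deriv (deriv u)) :=
  (hu.iterate_deriv' 0 2).continuous

theorem integral_unit_eq {f : ℝ → ℝ} (hf : Function.Periodic f 1) :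
    ∫ x in (-(1:ℝ)/2)..(1/2), f x = ∫ x in (0:ℝ)..1, f x := by
  have := hf.intervalIntegral_add_eq (-(1:ℝ)/2) 0
  norm_num at this ⊢
  exact this

theorem Function.Periodic.deriv {f : ℝ → ℝ} {p : ℝ} (hf : Function.Periodic f p) :
    Function.Periodic (deriv f) p := fun x => by
  rw [← deriv_comp_add_const]
  congr 1
  exact funext hf

theorem enstrophy_eq (hp : Function.Periodic u 1) :
    enstrophy u = (∫ x in (0:ℝ)..1, (-deriv u x) ^ 2) / 2 := by
  have h := hp.deriv
  rw [enstrophy, integral_unit_eq (fun x => by simp only [h x])]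
  simp only [neg_sq]
  ring

theorem rate_eq (hp : Function.Periodic u 1) :
    rate u = ∫ x in (0:ℝ)..1, ((-deriv u x) ^ 3 - (-deriv (deriv u) x) ^ 2) := by
  have h := hp.deriv
  have h' := h.deriv
  rw [rate, integral_unit_eq (fun x => by simp only [h x, h' x]), ← intervalIntegral.integral_neg]
  exact intervalIntegral.integral_congr fun x _ => by ring

theorem isAdmissible_neg_deriv (hp : Function.Periodic u 1) (hu : ContDiff ℝ 2 u) :
    IsAdmissible (2 * enstrophy u) (fun x => -deriv u x) (fun x => -deriv (deriv u) x) := by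
  have hd : ∀ x, HasDerivAt u (deriv u x) x := fun x =>
    (hu.differentiable two_ne_zero x).hasDerivAt
  refine ⟨fun x => (hasDerivAt_deriv_of_contDiff hu x).neg,
    (continuous_deriv_deriv_of_contDiff hu).neg, fun x => by simp only [hp.deriv x], ?_, ?_⟩
  · rw [intervalIntegral.integral_neg, integral_eq_sub_of_hasDerivAt (fun x _ => hd x)
      ((hu.continuous_deriv one_le_two).intervalIntegrable _ _)]
    have := hp 0
    rw [zero_add] at this
    rw [this, sub_self, neg_zero]
  · rw [enstrophy_eq hp]
    ring

namespace IsAdmissible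

variable {c : ℝ} {v v' : ℝ → ℝ}

theorem hasDerivAt_primitive (hv : IsAdmissible c v v') (x : ℝ) :
    HasDerivAt (fun x => -∫ t in (0:ℝ)..x, v t) (-v x) x :=
  ((hv.continuous.integral_hasStrictDerivAt 0 x).hasDerivAt).neg

theorem deriv_primitive (hv : IsAdmissible c v v') :
    deriv (fun x => -∫ t in (0:ℝ)..x, v t) = fun x => -v x :=
  funext fun x => (hv.hasDerivAt_primitive x).deriv

theorem deriv_deriv_primitive (hv : IsAdmissible c v v') :
    deriv (deriv (fun x => -∫ t in (0:ℝ)..x, v t)) = fun x => -v' x := by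
  rw [hv.deriv_primitive]
  exact funext fun x => (hv.hasDeriv x).neg.deriv

theorem contDiff_primitive (hv : IsAdmissible c v v') :
    ContDiff ℝ 2 (fun x => -∫ t in (0:ℝ)..x, v t) := by
  rw [show (2 : WithTop ℕ∞) = 1 + 1 by norm_num, contDiff_succ_iff_deriv]
  refine ⟨fun x => (hv.hasDerivAt_primitive x).differentiableAt, by simp, ?_⟩
  rw [contDiff_one_iff_deriv, hv.deriv_deriv_primitive, hv.deriv_primitive]
  exact ⟨fun x => (hv.hasDeriv x).neg.differentiableAt, hv.continuous_deriv.neg⟩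

theorem periodic_primitive (hv : IsAdmissible c v v') :
    Function.Periodic (fun x => -∫ t in (0:ℝ)..x, v t) 1 := fun x => by
  have := _root_.periodic_primitive hv.continuous hv.periodic hv.integral_eq_zero x
  simp only at this ⊢
  rw [this]

theorem enstrophy_primitive (hv : IsAdmissible c v v') :
    enstrophy (fun x => -∫ t in (0:ℝ)..x, v t) = c / 2 := by
  rw [enstrophy_eq hv.periodic_primitive, hv.deriv_primitive]
  simp only [neg_neg]
  rw [hv.integral_sq]

theorem rate_primitive (hv : IsAdmissible c v v') :
    rate (fun x => -∫ t in (0:ℝ)..x, v t) = ∫ x in (0:ℝ)..1, (v x ^ 3 - v' x ^ 2) := by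
  rw [rate_eq hv.periodic_primitive, hv.deriv_deriv_primitive, hv.deriv_primitive]
  simp only [neg_neg]

end IsAdmissible

namespace IsOddMaximizer

variable {𝓔 : ℝ}

theorem isMaximizer (hu : IsOddMaximizer 𝓔 u) :
    IsMaximizer (2 * 𝓔) (fun x => -deriv u x) (fun x => -deriv (deriv u) x) := by
  obtain ⟨-, hp, hC, -, hE, hmax⟩ := hu
  subst hE
  refine ⟨isAdmissible_neg_deriv hp hC, fun v v' hv => ?_⟩
  rw [← rate_eq hp, ← hv.rate_primitive]
  refine hmax _ hv.periodic_primitive hv.contDiff_primitive ?_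
  rw [hv.enstrophy_primitive]
  ring

/-- Odd maximizers are primitives of crest waves. -/
theorem eq_primitive {s : ℝ} (hs : 1000 ≤ s) (hE : crestNormSq s = 2 * 𝓔)
    (hu : IsOddMaximizer 𝓔 u) : u = fun x => -∫ t in (0:ℝ)..x, crestWave s t := by
  have hmax := hu.isMaximizer
  obtain ⟨hodd, hp, hC, hneg, -, -⟩ := hu
  have heven : ∀ x, deriv u (-x) = deriv u x := fun x => by
    have h1 : (fun x => u (-x)) = fun x => -u x := funext hodd
    have h2 := congrFun (congrArg deriv h1) x
    rw [deriv_comp_neg, deriv.fun_neg] at h2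
    linarith
  have hd0 : deriv (deriv u) 0 = 0 := by
    have h1 : (fun x => deriv u (-x)) = deriv u := funext heven
    have h2 := congrFun (congrArg deriv h1) 0
    rw [deriv_comp_neg, neg_zero] at h2
    linarith
  rw [← hE] at hmax
  have heq := hmax.eq_crestWave_self hs (by simp [hd0]) (by simpa using hneg)
  have hu0 : u 0 = 0 := by
    have := hodd 0
    rw [neg_zero] at this
    linarith
  funext x
  rw [← heq, intervalIntegral.integral_neg, neg_neg, integral_eq_sub_of_hasDerivAt
    (fun x _ => (hC.differentiable two_ne_zero x).hasDerivAt)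
    ((hC.continuous_deriv one_le_two).intervalIntegrable _ _), hu0, sub_zero]

end IsOddMaximizer

theorem isOddMaximizer_primitive {s 𝓔 : ℝ} (hs : 1000 ≤ s) (hE : crestNormSq s = 2 * 𝓔) :
    IsOddMaximizer 𝓔 (fun x => -∫ t in (0:ℝ)..x, crestWave s t) := by
  have hmax := isMaximizer_crestWave hs
  have hadm := hmax.toIsAdmissible
  refine ⟨fun x => ?_, hadm.periodic_primitive, hadm.contDiff_primitive, ?_, ?_,
    fun v hv hC hvE => ?_⟩
  · have := intervalIntegral.integral_comp_neg (a := 0) (b := x) (crestWave s)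
    rw [neg_zero] at this
    simp only
    rw [intervalIntegral.integral_symm (-x) 0, ← this, neg_neg, neg_neg]
    refine intervalIntegral.integral_congr fun t _ => ?_
    simp only [crestWave, sechSum_neg]
  · rw [hadm.deriv_primitive]
    have h1 := (sechSum_sub_mem (k := s) (x := 0) (by linarith) (by norm_num)).1
    rw [mul_zero, sechSq_zero] at h1
    simp only [crestWave]
    nlinarith [sq_nonneg s]
  · rw [hadm.enstrophy_primitive, hE]
    ring
  · have h1 := isAdmissible_neg_deriv hv hC
    rw [hvE, ← hE] at h1
    rw [hadm.rate_primitive, rate_eq hv]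
    exact hmax.le _ _ h1

end Bridge

/-- The primitive of the crest wave is a viscous shock on a linear rarefactive wave. -/
theorem abs_primitive_crestWave_sub_le {k x : ℝ} (hk : 1 ≤ k) (hx : |x| ≤ 1 / 2) :
    |(-∫ t in (0:ℝ)..x, crestWave k t) - 4 * k * (2 * x - Real.tanh (k * x))| ≤
      20 * k ^ 2 * rexp (-k) := by
  have hk0 : 0 < k := by linarith
  have hc := (isCnoidal_crestWave hk0).continuous
  have hshock : ∀ t, HasDerivAt (fun t => 4 * k * (2 * t - Real.tanh (k * t)))
      (8 * k - 4 * k ^ 2 * sechSq (k * t)) t := fun t => by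
    refine ((((hasDerivAt_id t).const_mul 2).sub ((hasDerivAt_tanh' (k * t)).comp t
      ((hasDerivAt_id t).const_mul k))).const_mul (4 * k)).congr_deriv (by ring)
  have hint := integral_eq_sub_of_hasDerivAt (a := 0) (b := x)
    (f := fun t => (-∫ y in (0:ℝ)..t, crestWave k y) - 4 * k * (2 * t - Real.tanh (k * t)))
    (fun t _ => ((hc.integral_hasStrictDerivAt 0 t).hasDerivAt.neg).sub (hshock t))
    (by
      have : Continuous fun t => sechSq (k * t) := continuous_iff_continuousAt.2 fun t =>
        ((hasDerivAt_sechSq (k * t)).comp t ((hasDerivAt_id t).const_mul k)).continuousAt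
      exact Continuous.intervalIntegrable (by fun_prop) _ _)
  simp only [intervalIntegral.integral_same, mul_zero, Real.tanh_zero, sub_zero, neg_zero] at hint
  rw [← hint]
  have := norm_integral_le_of_norm_le_const (a := 0) (b := x)
    (f := fun t => -crestWave k t - (8 * k - 4 * k ^ 2 * sechSq (k * t)))
    (C := 40 * k ^ 2 * rexp (-k)) fun t ht => by
      have htx : |t| ≤ 1 / 2 := by
        have := abs_sub_left_of_mem_uIcc (uIoc_subset_uIcc ht)
        rw [sub_zero, sub_zero] at this
        exact this.trans hx
      obtain ⟨h1, h2⟩ := sechSum_sub_mem hk htx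
      rw [crestWave, Real.norm_eq_abs, abs_le]
      constructor <;> nlinarith [mul_nonneg (sq_nonneg k) h1,
        mul_nonneg (sq_nonneg k) (sub_nonneg.2 h2), mul_nonneg (sq_nonneg k) (exp_pos (-k)).le]
  rw [Real.norm_eq_abs, sub_zero] at this
  refine this.trans ?_
  have h3 : 0 ≤ 40 * k ^ 2 * rexp (-k) := by positivity
  nlinarith

theorem energy_eq_of_odd {u : ℝ → ℝ} (hu : Continuous u) (hodd : ∀ x, u (-x) = -u x) :
    energy u = ∫ x in (0:ℝ)..(1 / 2), u x ^ 2 := by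
  have h1 := intervalIntegral.integral_comp_neg (a := 0) (b := 1 / 2) (fun x => u x ^ 2)
  simp only [hodd, neg_sq, neg_zero] at h1
  have hi : ∀ a b, IntervalIntegrable (fun x => u x ^ 2) volume a b :=
    fun a b => (hu.pow 2).intervalIntegrable a b
  rw [energy, neg_div, ← integral_add_adjacent_intervals (hi _ 0) (hi 0 _), ← h1]
  ring

/-- Comparison with the inviscid sawtooth. -/
theorem abs_energy_primitive_sub_le {k : ℝ} (hk : 100 ≤ k)
    (hodd : ∀ x, (-∫ t in (0:ℝ)..(-x), crestWave k t) = -(-∫ t in (0:ℝ)..x, crestWave k t)) :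
    |energy (fun x => -∫ t in (0:ℝ)..x, crestWave k t) - 8 / 3 * k ^ 2| ≤ 312 * k := by
  have hk0 : 0 < k := by linarith
  have hcw := (isCnoidal_crestWave hk0).continuous
  set u : ℝ → ℝ := fun x => -∫ t in (0:ℝ)..x, crestWave k t with hu
  have huc : Continuous u := continuous_iff_continuousAt.2 fun x =>
    (hcw.integral_hasStrictDerivAt 0 x).hasDerivAt.neg.continuousAt
  rw [energy_eq_of_odd huc hodd]
  have hV : ∫ x in (0:ℝ)..(1 / 2), (4 * k * (2 * x - 1)) ^ 2 = 8 / 3 * k ^ 2 := by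
    rw [integral_eq_sub_of_hasDerivAt (f := fun x => 8 / 3 * k ^ 2 * (2 * x - 1) ^ 3)
      (fun x _ => ?_) (Continuous.intervalIntegrable (by fun_prop) _ _)]
    · ring
    · refine ((((((hasDerivAt_id x).const_mul 2).sub_const 1).pow 3).const_mul
        (8 / 3 * k ^ 2))).congr_deriv ?_
      simp
      ring
  have hG : ∫ x in (0:ℝ)..(1 / 2), 13 * k * (40 + 8 * k * rexp (-2 * (k * x))) =
      13 * k * (20 + 4 * (1 - rexp (-k))) := by
    rw [integral_eq_sub_of_hasDerivAt (f := fun x => 13 * k * (40 * x - 4 * rexp (-2 * (k * x))))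
      (fun x _ => ?_) (Continuous.intervalIntegrable (by fun_prop) _ _)]
    · rw [show -2 * (k * (1 / 2)) = -k by ring, mul_zero, mul_zero, mul_zero, exp_zero]
      ring
    · refine ((((hasDerivAt_id x).const_mul 40).sub ((((hasDerivAt_id x).const_mul k).const_mul
        (-2)).exp.const_mul 4)).const_mul (13 * k)).congr_deriv ?_
      simp only [id]
      ring
  rw [← hV, ← intervalIntegral.integral_sub (Continuous.intervalIntegrable (by fun_prop) _ _)
    (Continuous.intervalIntegrable (by fun_prop) _ _), ← Real.norm_eq_abs]
  have hle := norm_integral_le_of_norm_le (a := 0) (b := 1 / 2) (μ := volume)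
    (f := fun x => u x ^ 2 - (4 * k * (2 * x - 1)) ^ 2)
    (g := fun x => 13 * k * (40 + 8 * k * rexp (-2 * (k * x)))) (by norm_num)
    (Filter.Eventually.of_forall fun x hx => by
      have hx0 : 0 < x := hx.1
      have hx1 : x ≤ 1 / 2 := hx.2
      have h1 := abs_le.1 (abs_primitive_crestWave_sub_le (k := k) (x := x) (by linarith)
        (by rwa [abs_of_pos hx0]))
      have h2 := sq_mul_exp_neg_le hk0.le
      have h3 := one_sub_tanh_le (k * x)
      have h4 := Real.tanh_lt_one (k * x)
      have h5 : 0 ≤ Real.tanh (k * x) := by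
        rw [← Real.tanh_zero]; exact tanh_strictMono.monotone (by positivity)
      set T := Real.tanh (k * x)
      set e := rexp (-2 * (k * x))
      have h6 : |u x - 4 * k * (2 * x - 1)| ≤ 40 + 8 * k * e := by
        rw [abs_le]
        constructor <;> nlinarith
      have h7 : |u x + 4 * k * (2 * x - 1)| ≤ 13 * k := by
        rw [abs_le]
        constructor <;> nlinarith
      rw [Real.norm_eq_abs, sq_sub_sq, abs_mul]
      gcongr)
    (Continuous.intervalIntegrable (by fun_prop) _ _)
  refine hle.trans ?_
  rw [hG]
  nlinarith [exp_pos (-k)]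

theorem crestNormSq_thousand_pos : 0 < crestNormSq 1000 := by
  have := (abs_le.1 (abs_crestNormSq_sub_le (k := 1000) (by norm_num))).1
  linarith

theorem exists_crestNormSq_eq_of_thousand_le {c : ℝ} (hc : crestNormSq 1000 ≤ c) :
    ∃ s, 1000 ≤ s ∧ crestNormSq s = c := by
  have h100 : crestNormSq 100 < crestNormSq 1000 := crestNormSq_lt le_rfl (by norm_num)
  obtain ⟨s, hs, rfl⟩ := exists_crestNormSq_eq (h100.le.trans hc)
  refine ⟨s, ?_, rfl⟩
  by_contra! hlt
  exact hc.not_gt (crestNormSq_lt hs hlt)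

/-- Theorem 1: for large enstrophy `𝓔` the constrained maximization problem has a
unique odd maximizer `u_*` with `u_*'(0) < 0`, which is a viscous shock on the
background of a linear rarefactive wave, with the stated asymptotics of `K`, `E`, `R`. -/
theorem maximizer_existence_asymptotics :
    ∃ E₀ C : ℝ, 0 < E₀ ∧ 0 < C ∧ ∀ 𝓔 : ℝ, E₀ ≤ 𝓔 →
      (∃! ustar : ℝ → ℝ, IsOddMaximizer 𝓔 ustar) ∧
      ∀ ustar : ℝ → ℝ, IsOddMaximizer 𝓔 ustar →
        ∃ k : ℝ, 0 < k ∧ |𝓔 - 32/3 * k ^ 3| ≤ C * k ^ 2 ∧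
          (∀ x ∈ Set.Icc (-(1:ℝ)/2) (1/2),
            |ustar x - 4 * k * (2 * x - Real.tanh (k * x))| ≤ C * k ^ 2 * Real.exp (-k)) ∧
          |energy ustar - 8/3 * k ^ 2| ≤ C * k ∧
          |rate ustar - 256/5 * k ^ 5| ≤ C * k ^ 4 := by
  refine ⟨crestNormSq 1000 / 2, 600, half_pos crestNormSq_thousand_pos, by norm_num,
    fun 𝓔 h𝓔 => ?_⟩
  obtain ⟨s, hs, hsE⟩ := exists_crestNormSq_eq_of_thousand_le (c := 2 * 𝓔) (by linarith)
  have hs0 : 0 < s := by linarith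
  refine ⟨⟨_, isOddMaximizer_primitive hs hsE, fun u hu => hu.eq_primitive hs hsE⟩,
    fun u hu => ⟨s, hs0, ?_, fun x hx => ?_, ?_, ?_⟩⟩
  · have h1 := abs_le.1 (abs_crestNormSq_sub_le (k := s) (by linarith))
    rw [hsE] at h1
    rw [abs_le]
    constructor <;> nlinarith
  · rw [hu.eq_primitive hs hsE]
    refine (abs_primitive_crestWave_sub_le (by linarith) ?_).trans ?_
    · rw [neg_div] at hx
      exact abs_le.2 hx
    · gcongr
      norm_num
  · have hodd := hu.1
    rw [hu.eq_primitive hs hsE] at hodd ⊢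
    refine (abs_energy_primitive_sub_le (by linarith) hodd).trans ?_
    gcongr
    norm_num
  · rw [hu.eq_primitive hs hsE, (isAdmissible_crestWave hs0).rate_primitive]
    exact abs_rate_crestWave_sub_le (by linarith)
end

section
/- Fix Δ > 0. For k > 0 set l = (1+Δ) log(k) and let u₀ : ℝ → ℝ be the 1-periodic odd function defined on [-1/2,1/2] by u₀(x) = 4k(2x - tanh(lx)/tanh(l/2)), and let 𝓔 = E(u₀) = (1/2)∫_{-1/2}^{1/2} u₀'(x)² dx. Then there exist constants 0 < c₋ < c₊ and k₀ > 0 such that for all k ≥ k₀: c₋ 𝓔^{1/2} log(𝓔)^{-1/2} ≤ k ≤ c₊ 𝓔^{1/2} log(𝓔)^{-1/2} and c₋ 𝓔 log(𝓔)^{-1} ≤ K(u₀) ≤ c₊ 𝓔 log(𝓔)^{-1}, where K(u₀) = (1/2)∫_{-1/2}^{1/2} u₀(x)² dx. -/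
open MeasureTheory intervalIntegral Set Real

theorem Real.three_quarters_le_tanh {y : ℝ} (hy : 2 ≤ y) : 3 / 4 ≤ Real.tanh y := by
  rw [Real.tanh_eq, le_div_iff₀ (by positivity)]
  have h1 : 3 ≤ Real.exp y := by linarith [Real.add_one_le_exp y]
  have h2 : Real.exp y * Real.exp (-y) = 1 := by rw [← Real.exp_add]; simp
  nlinarith [Real.exp_pos (-y)]

theorem Real.hasDerivAt_tanh_one_sub_sq (y : ℝ) :
    HasDerivAt Real.tanh (1 - Real.tanh y ^ 2) y := by
  have h := (Real.hasDerivAt_sinh y).div (Real.hasDerivAt_cosh y) (Real.cosh_pos y).ne'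
  have hfun : Real.sinh / Real.cosh = Real.tanh := by
    funext z; simp [Real.tanh_eq_sinh_div_cosh]
  rw [hfun] at h
  refine h.congr_deriv ?_
  rw [Real.tanh_eq_sinh_div_cosh]
  have := (Real.cosh_pos y).ne'
  field_simp

theorem Real.hasDerivAt_tanh_const_mul (l x : ℝ) :
    HasDerivAt (fun x => Real.tanh (l * x)) (l * (1 - Real.tanh (l * x) ^ 2)) x := by
  have h := (Real.hasDerivAt_tanh_one_sub_sq (l * x)).comp x ((hasDerivAt_id x).const_mul l)
  exact h.congr_deriv (by simp; ring)

theorem Real.continuous_tanh_const_mul (l : ℝ) : Continuous fun x => Real.tanh (l * x) :=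
  continuous_iff_continuousAt.2 fun x => (Real.hasDerivAt_tanh_const_mul l x).continuousAt

/-- The normalised profile `2x - tanh(lx)/tanh(l/2)`. -/
noncomputable def shockProfile (l x : ℝ) : ℝ :=
  2 * x - Real.tanh (l * x) / Real.tanh (l / 2)

theorem hasDerivAt_shockProfile (l x : ℝ) :
    HasDerivAt (shockProfile l)
      (2 - l * (1 - Real.tanh (l * x) ^ 2) / Real.tanh (l / 2)) x := by
  have h := ((hasDerivAt_id x).const_mul 2).sub
    ((Real.hasDerivAt_tanh_const_mul l x).div_const (Real.tanh (l / 2)))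
  exact h.congr_deriv (by simp)

theorem continuous_shockProfile (l : ℝ) : Continuous (shockProfile l) :=
  continuous_iff_continuousAt.2 fun x => (hasDerivAt_shockProfile l x).continuousAt

theorem integral_deriv_shockProfile_sq {l : ℝ} (hT : Real.tanh (l / 2) ≠ 0) :
    ∫ x in (-(1:ℝ)/2)..(1/2), (2 - l * (1 - Real.tanh (l * x) ^ 2) / Real.tanh (l / 2)) ^ 2
      = 2 * l / Real.tanh (l / 2) - 2 * l * Real.tanh (l / 2) / 3 - 4 := by
  set T := Real.tanh (l / 2) with hTdef
  have hderiv : ∀ x ∈ uIcc (-(1:ℝ)/2) (1/2), HasDerivAt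
      (fun x => 4 * x - 4 / T * Real.tanh (l * x)
        + l / T ^ 2 * (Real.tanh (l * x) - Real.tanh (l * x) ^ 3 / 3))
      ((2 - l * (1 - Real.tanh (l * x) ^ 2) / T) ^ 2) x := by
    intro x _
    have ht := Real.hasDerivAt_tanh_const_mul l x
    have h := (((hasDerivAt_id x).const_mul 4).sub (ht.const_mul (4 / T))).add
      ((ht.sub ((ht.pow 3).div_const 3)).const_mul (l / T ^ 2))
    refine h.congr_deriv ?_
    push_cast
    field_simp
    ring
  have hcont := Real.continuous_tanh_const_mul l
  rw [integral_eq_sub_of_hasDerivAt hderiv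
    (Continuous.intervalIntegrable (by fun_prop) _ _)]
  have hp : Real.tanh (l * (1 / 2)) = T := by rw [hTdef]; congr 1; ring
  have hm : Real.tanh (l * (-1 / 2)) = -T := by
    rw [hTdef, ← Real.tanh_neg]; congr 1; ring
  simp only [hp, hm]
  field_simp
  ring

theorem integral_deriv_shockProfile_sq_mem_Icc {l : ℝ} (hl : 32 ≤ l) :
    ∫ x in (-(1:ℝ)/2)..(1/2), (2 - l * (1 - Real.tanh (l * x) ^ 2) / Real.tanh (l / 2)) ^ 2
      ∈ Icc l (4 * l) := by
  have hT := Real.three_quarters_le_tanh (y := l / 2) (by linarith)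
  have hT1 := Real.tanh_lt_one (l / 2)
  rw [integral_deriv_shockProfile_sq (by linarith)]
  set T := Real.tanh (l / 2)
  have hTpos : 0 < T := by linarith
  have h1 : 2 * l ≤ 2 * l / T := by rw [le_div_iff₀ hTpos]; nlinarith
  have h2 : 2 * l / T ≤ 8 / 3 * l := by rw [div_le_iff₀ hTpos]; nlinarith
  constructor <;> nlinarith

theorem integral_shockProfile_sq_mem_Icc {l : ℝ} (hl : 32 ≤ l) :
    ∫ x in (-(1:ℝ)/2)..(1/2), shockProfile l x ^ 2 ∈ Icc (1 / 128 : ℝ) 8 := by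
  have hT := Real.three_quarters_le_tanh (y := l / 2) (by linarith)
  have hT1 := Real.tanh_lt_one (l / 2)
  have hTpos : 0 < Real.tanh (l / 2) := by linarith
  have hcont := (continuous_shockProfile l).pow 2
  have hint : ∀ a b : ℝ, IntervalIntegrable (fun x => shockProfile l x ^ 2) volume a b :=
    fun a b => hcont.intervalIntegrable a b
  constructor
  · have h1 : ∫ _ in (1/8 : ℝ)..(1/4), (1/16 : ℝ) ≤
        ∫ x in (1/8 : ℝ)..(1/4), shockProfile l x ^ 2 := by
      refine integral_mono_on (by norm_num) (by simp) (hint _ _) fun x hx => ?_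
      have ht := Real.three_quarters_le_tanh (y := l * x) (by nlinarith [hx.1])
      have hq : 3 / 4 ≤ Real.tanh (l * x) / Real.tanh (l / 2) := by
        rw [le_div_iff₀ hTpos]; nlinarith
      have hw : shockProfile l x ≤ -(1 / 4) := by
        unfold shockProfile; linarith [hx.2]
      nlinarith
    have h2 : ∫ x in (1/8 : ℝ)..(1/4), shockProfile l x ^ 2 ≤
        ∫ x in (-(1:ℝ)/2)..(1/2), shockProfile l x ^ 2 :=
      integral_mono_interval (by norm_num) (by norm_num) (by norm_num)
        (Filter.Eventually.of_forall fun x => sq_nonneg _) (hint _ _)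
    rw [intervalIntegral.integral_const, smul_eq_mul] at h1
    linarith
  · have h1 : ∫ x in (-(1:ℝ)/2)..(1/2), shockProfile l x ^ 2 ≤
        ∫ _ in (-(1:ℝ)/2)..(1/2), (8 : ℝ) := by
      refine integral_mono_on (by norm_num) (hint _ _) (by simp) fun x hx => ?_
      have hq1 : Real.tanh (l * x) / Real.tanh (l / 2) ≤ 4 / 3 := by
        rw [div_le_iff₀ hTpos]; linarith [Real.tanh_lt_one (l * x)]
      have hq2 : -(4 / 3) ≤ Real.tanh (l * x) / Real.tanh (l / 2) := by
        rw [le_div_iff₀ hTpos]; linarith [Real.neg_one_lt_tanh (l * x)]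
      have hw1 : shockProfile l x ≤ 7 / 3 := by unfold shockProfile; linarith [hx.2]
      have hw2 : -(7 / 3) ≤ shockProfile l x := by unfold shockProfile; linarith [hx.1]
      nlinarith
    rw [intervalIntegral.integral_const, smul_eq_mul] at h1
    linarith

theorem energy_mem_Icc_of_eqOn {k l : ℝ} (hl : 32 ≤ l) {u : ℝ → ℝ}
    (hu : ∀ x ∈ Icc (-(1:ℝ)/2) (1/2), u x = 4 * k * shockProfile l x) :
    energy u ∈ Icc (k ^ 2 / 16) (64 * k ^ 2) := by
  have h : ∫ x in (-(1:ℝ)/2)..(1/2), u x ^ 2 =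
      16 * k ^ 2 * ∫ x in (-(1:ℝ)/2)..(1/2), shockProfile l x ^ 2 := by
    rw [← intervalIntegral.integral_const_mul]
    refine integral_congr_Ioo_of_le (by norm_num) fun x hx => ?_
    simp only [hu x (Ioo_subset_Icc_self hx)]
    ring
  obtain ⟨h1, h2⟩ := integral_shockProfile_sq_mem_Icc hl
  rw [energy, h]
  constructor <;> nlinarith [sq_nonneg k]

theorem enstrophy_mem_Icc_of_eqOn {k l : ℝ} (hl : 32 ≤ l) {u : ℝ → ℝ}
    (hu : ∀ x ∈ Icc (-(1:ℝ)/2) (1/2), u x = 4 * k * shockProfile l x) :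
    enstrophy u ∈ Icc (8 * k ^ 2 * l) (32 * k ^ 2 * l) := by
  have h : ∫ x in (-(1:ℝ)/2)..(1/2), deriv u x ^ 2 =
      16 * k ^ 2 * ∫ x in (-(1:ℝ)/2)..(1/2),
        (2 - l * (1 - Real.tanh (l * x) ^ 2) / Real.tanh (l / 2)) ^ 2 := by
    rw [← intervalIntegral.integral_const_mul]
    refine integral_congr_Ioo_of_le (by norm_num) fun x hx => ?_
    have hev : u =ᶠ[nhds x] fun x => 4 * k * shockProfile l x :=
      Filter.eventuallyEq_of_mem (Icc_mem_nhds hx.1 hx.2) hu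
    simp only [hev.deriv_eq, ((hasDerivAt_shockProfile l x).const_mul (4 * k)).deriv]
    ring
  obtain ⟨h1, h2⟩ := integral_deriv_shockProfile_sq_mem_Icc hl
  rw [enstrophy, h]
  constructor <;> nlinarith [sq_nonneg k]

theorem Real.log_mem_Icc_of_mem_Icc {k l E : ℝ} (hk : 0 < k) (hl : 32 ≤ l)
    (hkl : Real.log k ≤ l) (hE : E ∈ Icc (8 * k ^ 2 * l) (32 * k ^ 2 * l)) :
    Real.log E ∈ Icc (2 * Real.log k) (4 * l) := by
  have hk2 : 0 < k ^ 2 := by positivity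
  have hEpos : 0 < E := lt_of_lt_of_le (by positivity) hE.1
  constructor
  · have h := Real.log_le_log hk2 (show k ^ 2 ≤ E by nlinarith [hE.1])
    rwa [Real.log_pow, Nat.cast_ofNat] at h
  · have h := Real.log_le_log hEpos hE.2
    rw [Real.log_mul (by positivity) (by positivity), Real.log_mul (by positivity) (by positivity),
      Real.log_pow, Nat.cast_ofNat] at h
    have h32 := Real.log_le_sub_one_of_pos (show (0:ℝ) < 32 by norm_num)
    have hll := Real.log_le_sub_one_of_pos (show 0 < l by linarith)
    linarith

/-- Lemma 1: for the initial data `u₀(x) = 4k(2x - tanh(lx)/tanh(l/2))` with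
`l = (1+Δ)log k`, one has `k = 𝒪(𝓔^{1/2} log(𝓔)^{-1/2})` and
`K(u₀) = 𝒪(𝓔 log(𝓔)^{-1})` as `𝓔 = E(u₀) → ∞`. -/
theorem scaling_log_choice (Δ : ℝ) (hΔ : 0 < Δ) :
    ∃ cm cp k₀ : ℝ, 0 < cm ∧ cm < cp ∧ 0 < k₀ ∧
      ∀ k : ℝ, k₀ ≤ k → ∀ u₀ : ℝ → ℝ,
        (∀ x : ℝ, u₀ (x + 1) = u₀ x) →
        (∀ x ∈ Set.Icc (-(1:ℝ)/2) (1/2),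
          u₀ x = 4 * k * (2 * x -
            Real.tanh ((1 + Δ) * Real.log k * x) / Real.tanh ((1 + Δ) * Real.log k / 2))) →
        (cm * (enstrophy u₀) ^ ((1:ℝ)/2) * (Real.log (enstrophy u₀)) ^ (-(1:ℝ)/2) ≤ k ∧
          k ≤ cp * (enstrophy u₀) ^ ((1:ℝ)/2) * (Real.log (enstrophy u₀)) ^ (-(1:ℝ)/2)) ∧
        (cm * enstrophy u₀ * (Real.log (enstrophy u₀))⁻¹ ≤ energy u₀ ∧
          energy u₀ ≤ cp * enstrophy u₀ * (Real.log (enstrophy u₀))⁻¹) := by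
  have hd : 1 < 1 + Δ := by linarith
  have hd0 : 0 < 1 + Δ := by linarith
  have hcm : 1 / (256 * (1 + Δ)) ≤ 1 / 256 := by
    rw [div_le_div_iff₀ (by positivity) (by norm_num)]; linarith
  have hcm0 : 0 < 1 / (256 * (1 + Δ)) := by positivity
  refine ⟨1 / (256 * (1 + Δ)), 32, Real.exp 32, hcm0, by linarith, Real.exp_pos _,
    fun k hk u₀ _ hu => ?_⟩
  have hk0 : 0 < k := (Real.exp_pos _).trans_le hk
  have hL : 32 ≤ Real.log k := (Real.le_log_iff_exp_le hk0).2 hk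
  have hkl : Real.log k ≤ (1 + Δ) * Real.log k := by nlinarith
  have hl : 32 ≤ (1 + Δ) * Real.log k := hL.trans hkl
  have hK := energy_mem_Icc_of_eqOn hl hu
  have hE := enstrophy_mem_Icc_of_eqOn hl hu
  have hlog := Real.log_mem_Icc_of_mem_Icc hk0 hl hkl hE
  set E := enstrophy u₀
  have hk2 : 0 < k ^ 2 := by positivity
  have hE0 : 0 < E := lt_of_lt_of_le (by positivity) hE.1
  have hlogE : 0 < Real.log E := by linarith [hlog.1]
  have hR1 : 2 * k ^ 2 ≤ E / Real.log E := by
    rw [le_div_iff₀ hlogE]; nlinarith [hE.1, hlog.2]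
  have hR2 : E / Real.log E ≤ 16 * (1 + Δ) * k ^ 2 := by
    have h := mul_le_mul_of_nonneg_left hlog.1 (show 0 ≤ 16 * (1 + Δ) * k ^ 2 by positivity)
    rw [div_le_iff₀ hlogE]
    linarith [hE.2]
  have hcR : 1 / (256 * (1 + Δ)) * (E / Real.log E) ≤ k ^ 2 / 16 := by
    rw [one_div, inv_mul_le_iff₀ (by positivity)]; linarith
  have hsqrt : E ^ ((1:ℝ)/2) * Real.log E ^ (-(1:ℝ)/2) = √(E / Real.log E) := by
    rw [neg_div, Real.rpow_neg hlogE.le, ← Real.sqrt_eq_rpow, ← Real.sqrt_eq_rpow,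
      Real.sqrt_div hE0.le, div_eq_mul_inv]
  have hs0 := Real.sqrt_nonneg (E / Real.log E)
  have hs := Real.sq_sqrt (show 0 ≤ E / Real.log E by positivity)
  rw [mul_assoc, mul_assoc, hsqrt, mul_assoc, mul_assoc, ← div_eq_mul_inv]
  refine ⟨⟨?_, ?_⟩, ?_, ?_⟩
  · refine (sq_le_sq₀ (by positivity) hk0.le).1 ?_
    have hR0 : 0 ≤ E / Real.log E := by positivity
    rw [mul_pow, hs]
    nlinarith [mul_nonneg hcm0.le hR0]
  · refine (sq_le_sq₀ hk0.le (by positivity)).1 ?_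
    rw [mul_pow, hs]
    nlinarith
  · linarith [hK.1]
  · linarith [hK.2]
end
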